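/- arXiv:1201.5071 — 3 statements merged into one kernel-verified Lean document; each statement's English description precedes it below -/
import Mathlib

section
/- Let M be a finite-dimensional complex left central Leibniz algebra with dim C(M) = 1, with radical R, and let B be the subspace with R ⊆ B ⊆ M such that B/R is the solvable radical of the Lie algebra M/R. Then there exists a maximal element L of the poset of Lie subalgebras of M such that: (a) L is a maximal totally isotropic subspace of M; (b) the Lie algebra L/R is nilpotent; (c) L ⊆ B. -/
open Submodule

section LeibnizDefs

variable {M : Type*} [AddCommGroup M] [Module ℂ M]

/-- The left Leibniz identity for a bilinear bracket. -/
def IsLeftLeibniz (br : M →ₗ[ℂ] M →ₗ[ℂ] M) : Prop :=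
  ∀ a b c : M, br a (br b c) = br (br a b) c + br b (br a c)

/-- The right Leibniz identity for a bilinear bracket. -/
def IsRightLeibniz (br : M →ₗ[ℂ] M →ₗ[ℂ] M) : Prop :=
  ∀ a b c : M, br (br a b) c = br (br a c) b + br a (br b c)

/-- Left central: `[a,[b,b]] = 0` for all `a, b`. -/
def IsLeftCentral (br : M →ₗ[ℂ] M →ₗ[ℂ] M) : Prop :=
  ∀ a b : M, br a (br b b) = 0

/-- The Leibniz kernel `C(M)`, the span of all squares `[a,a]`. -/
def leibnizKernel (br : M →ₗ[ℂ] M →ₗ[ℂ] M) : Submodule ℂ M :=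
  Submodule.span ℂ {x | ∃ a : M, br a a = x}

/-- A two-sided ideal of a Leibniz algebra. -/
def IsTwoSidedIdeal (br : M →ₗ[ℂ] M →ₗ[ℂ] M) (U : Submodule ℂ M) : Prop :=
  ∀ m u : M, u ∈ U → br m u ∈ U ∧ br u m ∈ U

/-- A Lie subalgebra: a subspace closed under the bracket on which the bracket is alternating. -/
def IsLieSubalgebra (br : M →ₗ[ℂ] M →ₗ[ℂ] M) (L : Submodule ℂ M) : Prop :=
  (∀ a ∈ L, ∀ b ∈ L, br a b ∈ L) ∧ ∀ a ∈ L, br a a = 0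

/-- The derived series of a subspace. -/
def leibDerivedSeries (br : M →ₗ[ℂ] M →ₗ[ℂ] M) (U : Submodule ℂ M) : ℕ → Submodule ℂ M
  | 0 => U
  | n + 1 => Submodule.span ℂ
      {x | ∃ a ∈ leibDerivedSeries br U n, ∃ b ∈ leibDerivedSeries br U n, br a b = x}

/-- Solvability of a subspace. -/
def IsLeibnizSolvable (br : M →ₗ[ℂ] M →ₗ[ℂ] M) (U : Submodule ℂ M) : Prop :=
  ∃ n : ℕ, leibDerivedSeries br U n = ⊥

/-- `B` is the solvable radical: the largest solvable two-sided ideal. -/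
def IsSolvableRadical (br : M →ₗ[ℂ] M →ₗ[ℂ] M) (B : Submodule ℂ M) : Prop :=
  IsTwoSidedIdeal br B ∧ IsLeibnizSolvable br B ∧
    ∀ U : Submodule ℂ M, IsTwoSidedIdeal br U → IsLeibnizSolvable br U → U ≤ B

/-- Semisimplicity of a bracket-closed subspace `S` on which the bracket is a Lie bracket,
expressed via the standard characterization (valid for finite-dimensional complex Lie
algebras): `S` has no nonzero abelian ideal. -/
def IsSemisimpleSubalgebra (br : M →ₗ[ℂ] M →ₗ[ℂ] M) (S : Submodule ℂ M) : Prop :=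
  ∀ A : Submodule ℂ M, A ≤ S →
    (∀ s ∈ S, ∀ a ∈ A, br s a ∈ A ∧ br a s ∈ A) →
    (∀ a ∈ A, ∀ b ∈ A, br a b = 0) → A = ⊥

/-- The truncated exponential series of an endomorphism; if `f ^ n = 0` this is `exp f`. -/
noncomputable def expSum (f : Module.End ℂ M) (n : ℕ) : Module.End ℂ M :=
  ∑ i ∈ Finset.range n, ((i.factorial : ℂ)⁻¹) • f ^ i

/-- A subspace `A` with `R ≤ A` whose image in `M/R` is a (two-sided) ideal. -/
def IsIdealAbove (br : M →ₗ[ℂ] M →ₗ[ℂ] M) (R A : Submodule ℂ M) : Prop :=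
  R ≤ A ∧ ∀ m a : M, a ∈ A → br m a ∈ A ∧ br a m ∈ A

/-- The derived series relative to `R` (computing the derived series of the image in `M/R`). -/
def derivedSeriesMod (br : M →ₗ[ℂ] M →ₗ[ℂ] M) (R U : Submodule ℂ M) : ℕ → Submodule ℂ M
  | 0 => U ⊔ R
  | n + 1 => Submodule.span ℂ
      {x | ∃ a ∈ derivedSeriesMod br R U n, ∃ b ∈ derivedSeriesMod br R U n, br a b = x} ⊔ R

/-- Solvability of the image of `U` in `M/R`. -/
def IsSolvableMod (br : M →ₗ[ℂ] M →ₗ[ℂ] M) (R U : Submodule ℂ M) : Prop :=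
  ∃ n : ℕ, derivedSeriesMod br R U n ≤ R

/-- `B/R` is the solvable radical of `M/R`. -/
def IsSolvableRadicalMod (br : M →ₗ[ℂ] M →ₗ[ℂ] M) (R B : Submodule ℂ M) : Prop :=
  IsIdealAbove br R B ∧ IsSolvableMod br R B ∧
    ∀ U : Submodule ℂ M, IsIdealAbove br R U → IsSolvableMod br R U → U ≤ B

/-- Semisimplicity of `L/R` as a Lie algebra, expressed via the standard characterization:
no ideal of `L/R` strictly between `R` and `L` is abelian, except the zero one. -/
def IsSemisimpleMod (br : M →ₗ[ℂ] M →ₗ[ℂ] M) (R L : Submodule ℂ M) : Prop :=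
  ∀ A : Submodule ℂ M, R ≤ A → A ≤ L →
    (∀ l ∈ L, ∀ a ∈ A, br l a ∈ A ∧ br a l ∈ A) →
    (∀ a ∈ A, ∀ b ∈ A, br a b ∈ R) → A = R

/-- The lower central series of `L` relative to `R`. -/
def lowerCentralSeriesMod (br : M →ₗ[ℂ] M →ₗ[ℂ] M) (R L : Submodule ℂ M) :
    ℕ → Submodule ℂ M
  | 0 => L ⊔ R
  | n + 1 => Submodule.span ℂ
      {x | ∃ a ∈ L, ∃ b ∈ lowerCentralSeriesMod br R L n, br a b = x} ⊔ R

/-- Nilpotency of `L/R`. -/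
def IsNilpotentMod (br : M →ₗ[ℂ] M →ₗ[ℂ] M) (R L : Submodule ℂ M) : Prop :=
  ∃ n : ℕ, lowerCentralSeriesMod br R L n ≤ R

/-- A totally isotropic subspace for the pairing `ψ(a,b) = [a,b] + [b,a]`. -/
def IsTotallyIsotropic (br : M →ₗ[ℂ] M →ₗ[ℂ] M) (U : Submodule ℂ M) : Prop :=
  ∀ a ∈ U, ∀ b ∈ U, br a b + br b a = 0

end LeibnizDefs

section Sl2

attribute [local instance] LieRing.ofAssociativeRing

variable {K V : Type*} [Field K] [CharZero K] [AddCommGroup V] [Module K V]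
  [FiniteDimensional K V] {E H F : Module.End K V}

lemma eq_zero_of_sl2_weight_neg_two (hHE : ⁅H, E⁆ = 2 • E) (hHF : ⁅H, F⁆ = -(2 • F))
    (hEF : ⁅E, F⁆ = H) {v : V} (hE : E v = 0) (hH : H v = (-2 : K) • v) : v = 0 := by
  by_contra hv
  have hH0 : H ≠ 0 := by
    rintro rfl
    simp [hv] at hH
  have t : IsSl2Triple H E F := ⟨hH0, hEF, hHE, hHF⟩
  have P : t.HasPrimitiveVectorWith v (-2 : K) := ⟨hv, hH, hE⟩
  obtain ⟨n, hn⟩ := P.exists_nat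
  have : ((n + 2 : ℕ) : K) = 0 := by push_cast; rw [← hn]; ring
  exact absurd this (Nat.cast_ne_zero.mpr (by omega))

lemma exists_sl2_add_two_smul_eq (hHE : ⁅H, E⁆ = 2 • E) (hHF : ⁅H, F⁆ = -(2 • F))
    (hEF : ⁅E, F⁆ = H) {v : V} (hE : E v = 0) : ∃ u, E u = 0 ∧ H u + (2 : K) • u = v := by
  have hinv : ∀ x ∈ LinearMap.ker E, (H + (2 : K) • (1 : Module.End K V)) x ∈ LinearMap.ker E := by
    intro x hx
    rw [LinearMap.mem_ker] at hx ⊢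
    have := LinearMap.congr_fun hHE x
    simp [Ring.lie_def, hx] at this
    simp [hx, this]
  let D := (H + (2 : K) • (1 : Module.End K V)).restrict hinv
  have hD : Function.Injective D := by
    rw [← LinearMap.ker_eq_bot, LinearMap.ker_eq_bot']
    rintro ⟨x, hx⟩ h
    have h' : H x + (2 : K) • x = 0 := by simpa [D] using congrArg Subtype.val h
    ext
    exact eq_zero_of_sl2_weight_neg_two hHE hHF hEF hx
      (by rw [eq_neg_of_add_eq_zero_left h', neg_smul])
  obtain ⟨⟨u, hu⟩, h⟩ := LinearMap.injective_iff_surjective.mp hD ⟨v, hE⟩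
  exact ⟨u, hu, by simpa [D] using congrArg Subtype.val h⟩

lemma dual_eq_zero_of_sl2_weight_neg_two (hHE : ⁅H, E⁆ = 2 • E) (hHF : ⁅H, F⁆ = -(2 • F))
    (hEF : ⁅E, F⁆ = H) {ξ : Module.Dual K V} (hE : ξ ∘ₗ E = 0) (hH : ξ ∘ₗ H = (2 : K) • ξ) :
    ξ = 0 := by
  have key (A B : Module.End K V) : ⁅-A.dualMap, -B.dualMap⁆ = -(⁅A, B⁆).dualMap := by
    ext η x
    simp [Ring.lie_def]
  refine eq_zero_of_sl2_weight_neg_two (E := -E.dualMap) (H := -H.dualMap) (F := -F.dualMap)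
    ?_ ?_ ?_ ?_ ?_
  · rw [key, hHE]; ext; simp
  · rw [key, hHF]; ext; simp
  · rw [key, hEF]
  · ext x; simpa using LinearMap.congr_fun hE x
  · ext x; simpa using LinearMap.congr_fun hH x

lemma exists_sl2_sub_two_smul_add_eq (hHE : ⁅H, E⁆ = 2 • E) (hHF : ⁅H, F⁆ = -(2 • F))
    (hEF : ⁅E, F⁆ = H) (v : V) : ∃ u w, H u - (2 : K) • u + E w = v := by
  have htop : LinearMap.range (H - (2 : K) • (1 : Module.End K V)) ⊔ LinearMap.range E = ⊤ := by
    by_contra hne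
    obtain ⟨ξ, hξ, hle⟩ := Submodule.exists_le_ker_of_lt_top _ (lt_top_iff_ne_top.mpr hne)
    refine hξ (dual_eq_zero_of_sl2_weight_neg_two hHE hHF hEF ?_ ?_)
    · ext x
      exact hle (Submodule.mem_sup_right ⟨x, rfl⟩)
    · ext x
      have := hle (Submodule.mem_sup_left ⟨x, rfl⟩)
      simpa [sub_eq_zero] using this
  obtain ⟨_, ⟨u, rfl⟩, _, ⟨w, rfl⟩, h⟩ := Submodule.mem_sup.mp (htop ▸ Submodule.mem_top : v ∈ _)
  exact ⟨u, w, by simpa using h⟩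

lemma mem_range_of_sl2_apply_mem_range (hHE : ⁅H, E⁆ = 2 • E) (hHF : ⁅H, F⁆ = -(2 • F))
    (hEF : ⁅E, F⁆ = H)
    (hinv : ∀ ξ : Module.Dual K V, ξ ∘ₗ E = 0 → ξ ∘ₗ H = 0 → ξ ∘ₗ F = 0 → ξ = 0)
    {w : V} (hw : H w ∈ LinearMap.range E) : w ∈ LinearMap.range E := by
  have hHr : LinearMap.range E ≤ (LinearMap.range E).comap H := by
    rintro _ ⟨x, rfl⟩
    have := LinearMap.congr_fun hHE x
    simp [Ring.lie_def, sub_eq_iff_eq_add] at this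
    exact ⟨2 • x + H x, by simp [this]⟩
  let D := (LinearMap.range E).mapQ _ H hHr
  have hD : Function.Surjective D := by
    rw [← LinearMap.range_eq_top]
    by_contra hne
    obtain ⟨η, hη, hle⟩ := Submodule.exists_le_ker_of_lt_top _ (lt_top_iff_ne_top.mpr hne)
    let ξ : Module.Dual K V := η ∘ₗ (LinearMap.range E).mkQ
    have hξE : ξ ∘ₗ E = 0 := by
      ext x
      have : (LinearMap.range E).mkQ (E x) = 0 := by simp
      simp only [ξ, LinearMap.comp_apply, this, map_zero, LinearMap.zero_apply]
    have hξH : ξ ∘ₗ H = 0 := by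
      ext x
      exact hle ⟨(LinearMap.range E).mkQ x, rfl⟩
    have hξF : ξ ∘ₗ F = 0 := by
      refine dual_eq_zero_of_sl2_weight_neg_two hHE hHF hEF ?_ ?_
      · ext x
        have h1 := LinearMap.congr_fun hEF x
        have h2 := LinearMap.congr_fun hξE (F x)
        have h3 := LinearMap.congr_fun hξH x
        simp only [Ring.lie_def, LinearMap.sub_apply, Module.End.mul_apply] at h1
        simp only [LinearMap.comp_apply, LinearMap.zero_apply, ← h1, map_sub] at h2 h3 ⊢
        simpa [h2] using h3
      · ext x
        have h1 := LinearMap.congr_fun hHF x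
        have h3 := LinearMap.congr_fun hξH (F x)
        have h4 := congrArg ξ h1
        simp [Ring.lie_def] at h3 h4
        simp [h3] at h4
        simpa using h4
    have := hinv ξ hξE hξH hξF
    refine hη (LinearMap.ext fun y ↦ ?_)
    obtain ⟨x, rfl⟩ := Submodule.mkQ_surjective _ y
    exact LinearMap.congr_fun this x
  have hDi := LinearMap.injective_iff_surjective.mpr hD
  have : D ((LinearMap.range E).mkQ w) = 0 := by
    simpa [D] using hw
  rw [← D.map_zero] at this
  simpa using hDi this

end Sl2

section Lifting

open LieAlgebra Module

variable {K G : Type*} [Field K] [LieRing G] [LieAlgebra K G]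

/-- The elements `h`, `e`, `f` satisfy the `sl₂` relations modulo the ideal `A`. -/
structure IsSl2TripleMod (A : LieIdeal K G) (h e f : G) : Prop where
  lie_h_e : ⁅h, e⁆ - (2 : K) • e ∈ A
  lie_h_f : ⁅h, f⁆ + (2 : K) • f ∈ A
  lie_e_f : ⁅e, f⁆ - h ∈ A

/-- Any `sl₂` triple modulo `A` can be corrected by elements of `A` to an `sl₂` triple modulo
`A'`. -/
def LiftsSl2Triples (A A' : LieIdeal K G) : Prop :=
  ∀ h e f : G, IsSl2TripleMod A h e f →
    ∃ h' e' f' : G, IsSl2TripleMod A' h' e' f' ∧ h' - h ∈ A ∧ e' - e ∈ A ∧ f' - f ∈ A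

lemma exists_sl2TripleMod_bot_of_central [CharZero K] {A : LieIdeal K G}
    (hA : ∀ x : G, ∀ a ∈ A, ⁅x, a⁆ = 0) : LiftsSl2Triples A ⊥ := by
  rintro h e f ⟨h1, h2, h3⟩
  have hA' : ∀ x : G, ∀ a ∈ A, ⁅a, x⁆ = 0 := fun x a ha ↦ by rw [← lie_skew, hA x a ha, neg_zero]
  obtain ⟨v, hv, hv'⟩ : ∃ v ∈ A, ⁅h, e⁆ = (2 : K) • e + v := ⟨_, h1, by abel⟩
  obtain ⟨u, hu, hu'⟩ : ∃ v ∈ A, ⁅h, f⁆ = -(2 : K) • f + v := ⟨_, h2, by rw [neg_smul]; abel⟩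
  obtain ⟨w, hw, hw'⟩ : ∃ v ∈ A, ⁅e, f⁆ = h + v := ⟨_, h3, by abel⟩
  refine ⟨h + w, e + (2 : K)⁻¹ • v, f - (2 : K)⁻¹ • u, ⟨?_, ?_, ?_⟩, ?_, ?_, ?_⟩
  · simp [hA _ _ hv, hA' _ _ hw, hv']
  · simp [hA _ _ hu, hA' _ _ hw, hu', smul_sub]
  · simp [hA _ _ hu, hA' _ _ hv, hw']
  · simpa
  · simpa using A.smul_mem _ hv
  · simpa using A.smul_mem _ hu

lemma exists_sl2TripleMod_bot_of_abelian [CharZero K] [FiniteDimensional K G] {A : LieIdeal K G}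
    (hA : ∀ a ∈ A, ∀ b ∈ A, ⁅a, b⁆ = 0) {h e f : G} (t : IsSl2TripleMod A h e f)
    (hinv : ∀ ξ : Dual K A, (∀ a : A, ξ ⁅e, a⁆ = 0) → (∀ a : A, ξ ⁅h, a⁆ = 0) →
      (∀ a : A, ξ ⁅f, a⁆ = 0) → ξ = 0) :
    ∃ h' e' f' : G, IsSl2TripleMod (⊥ : LieIdeal K G) h' e' f' ∧
      h' - h ∈ A ∧ e' - e ∈ A ∧ f' - f ∈ A := by
  obtain ⟨h1, h2, h3⟩ := t
  obtain ⟨v, hv, hv'⟩ : ∃ v ∈ A, ⁅h, e⁆ = (2 : K) • e + v := ⟨_, h1, by abel⟩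
  obtain ⟨u, hu, hu'⟩ : ∃ v ∈ A, ⁅h, f⁆ = -((2 : K) • f) + v := ⟨_, h2, by abel⟩
  obtain ⟨w, hw, hw'⟩ : ∃ v ∈ A, ⁅e, f⁆ = h + v := ⟨_, h3, by abel⟩
  let T (x : G) : End K A := LieModule.toEnd K G A x
  have hT (x : G) (a : A) : ((T x a : A) : G) = ⁅x, (a : G)⁆ := rfl
  have hHE : T h * T e - T e * T h = 2 • T e := by
    ext a
    have : ⁅⁅h, e⁆, (a : G)⁆ = (2 : K) • ⁅e, (a : G)⁆ := by simp [hv', hA v hv a a.2]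
    rw [lie_lie] at this
    simpa [hT, two_smul] using this
  have hHF : T h * T f - T f * T h = -(2 • T f) := by
    ext a
    have : ⁅⁅h, f⁆, (a : G)⁆ = -((2 : K) • ⁅f, (a : G)⁆) := by simp [hu', hA u hu a a.2]
    rw [lie_lie] at this
    simpa [hT, two_smul] using this
  have hEF : T e * T f - T f * T e = T h := by
    ext a
    have : ⁅⁅e, f⁆, (a : G)⁆ = ⁅h, (a : G)⁆ := by simp [hw', hA w hw a a.2]
    rw [lie_lie] at this
    simpa [hT] using this
  obtain ⟨u₁, w₁, huw⟩ := exists_sl2_sub_two_smul_add_eq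
    (E := T e) (H := T h) (F := T f) hHE hHF hEF (⟨v, hv⟩ : A)
  replace huw : ⁅h, (u₁ : G)⁆ - (2 : K) • (u₁ : G) + ⁅e, (w₁ : G)⁆ = v := congrArg Subtype.val huw
  obtain ⟨e₁, he₁⟩ : ∃ e₁, e₁ = e - (u₁ : G) := ⟨_, rfl⟩
  obtain ⟨h₁, hh₁⟩ : ∃ h₁, h₁ = h + (w₁ : G) := ⟨_, rfl⟩
  have key₁ : ⁅h₁, e₁⁆ = (2 : K) • e₁ := by
    have : ⁅(w₁ : G), e⁆ = -⁅e, (w₁ : G)⁆ := (lie_skew _ _).symm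
    simp only [he₁, hh₁, add_lie, lie_sub, hA _ w₁.2 _ u₁.2, hv', ← huw, this, smul_sub]
    abel
  have hE (a : G) (ha : a ∈ A) : ⁅e₁, a⁆ = ⁅e, a⁆ := by simp [he₁, hA _ u₁.2 _ ha]
  have hH (a : G) (ha : a ∈ A) : ⁅h₁, a⁆ = ⁅h, a⁆ := by simp [hh₁, hA _ w₁.2 _ ha]
  have hle (x : G) {a : G} (ha : a ∈ A) : ⁅x, a⁆ ∈ A := lie_mem_right K G A x a ha
  have hle' (x : G) {a : G} (ha : a ∈ A) : ⁅a, x⁆ ∈ A := lie_mem_left K G A a x ha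
  obtain ⟨w₂, hw₂, hw₂'⟩ : ∃ v ∈ A, ⁅e₁, f⁆ = h₁ + v := by
    refine ⟨w - ⁅(u₁ : G), f⁆ - w₁, A.sub_mem (A.sub_mem hw (hle' _ u₁.2)) w₁.2, ?_⟩
    simp only [he₁, hh₁, sub_lie, hw']; abel
  obtain ⟨v₂, hv₂, hv₂'⟩ : ∃ v ∈ A, ⁅h₁, f⁆ = -((2 : K) • f) + v := by
    refine ⟨u + ⁅(w₁ : G), f⁆, A.add_mem hu (hle' _ w₁.2), ?_⟩
    simp only [hh₁, add_lie, hu']; abel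
  have hmem : ⁅h₁, w₂⁆ = ⁅e₁, v₂⁆ := by
    have := leibniz_lie h₁ e₁ f
    rw [hw₂', key₁, hv₂', lie_add, lie_self, zero_add, smul_lie, hw₂', lie_add, lie_neg, lie_smul,
      hw₂'] at this
    rw [this]; abel
  obtain ⟨u₂, hu₂⟩ := mem_range_of_sl2_apply_mem_range (E := T e) (H := T h) (F := T f) hHE hHF hEF
    (fun ξ ha hb hc ↦ hinv ξ (LinearMap.congr_fun ha) (LinearMap.congr_fun hb)
      (LinearMap.congr_fun hc)) (w := (⟨w₂, hw₂⟩ : A))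
    ⟨⟨v₂, hv₂⟩, Subtype.ext (by rw [hT, hT, ← hE _ hv₂, ← hH _ hw₂, hmem])⟩
  replace hu₂ : ⁅e, (u₂ : G)⁆ = w₂ := congrArg Subtype.val hu₂
  obtain ⟨f₁, hf₁⟩ : ∃ f₁, f₁ = f - (u₂ : G) := ⟨_, rfl⟩
  have key₂ : ⁅e₁, f₁⁆ = h₁ := by
    rw [hf₁, lie_sub, hw₂', hE _ u₂.2, hu₂]; abel
  obtain ⟨v₃, hv₃, hv₃'⟩ : ∃ v ∈ A, ⁅h₁, f₁⁆ = -((2 : K) • f₁) + v := by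
    refine ⟨v₂ - ⁅h₁, (u₂ : G)⁆ - (2 : K) • (u₂ : G),
      A.sub_mem (A.sub_mem hv₂ (hle _ u₂.2)) (A.smul_mem _ u₂.2), ?_⟩
    simp only [hf₁, lie_sub, hv₂', smul_sub]; abel
  have hker : ⁅e₁, v₃⁆ = 0 := by
    have := leibniz_lie h₁ e₁ f₁
    rw [key₂, key₁, hv₃', lie_self, smul_lie, key₂, lie_add, lie_neg, lie_smul, key₂] at this
    rw [← add_assoc, add_neg_cancel, zero_add] at this
    exact this.symm
  obtain ⟨u₃, hu₃, hu₃'⟩ := exists_sl2_add_two_smul_eq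
    (E := T e) (H := T h) (F := T f) hHE hHF hEF (v := (⟨v₃, hv₃⟩ : A))
    (Subtype.ext (by rw [hT, ← hE _ hv₃, hker]; rfl))
  replace hu₃ : ⁅e, (u₃ : G)⁆ = 0 := congrArg Subtype.val hu₃
  replace hu₃' : ⁅h, (u₃ : G)⁆ + (2 : K) • (u₃ : G) = v₃ := congrArg Subtype.val hu₃'
  refine ⟨h₁, e₁, f₁ - u₃, ⟨?_, ?_, ?_⟩, ?_, ?_, ?_⟩
  · simp [key₁]
  · have : ⁅h₁, f₁ - u₃⁆ + (2 : K) • (f₁ - (u₃ : G)) = 0 := by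
      rw [lie_sub, hv₃', hH _ u₃.2, ← hu₃', smul_sub]; abel
    rw [this]
    exact zero_mem _
  · simp [key₂, hE _ u₃.2, hu₃]
  · simp [hh₁]
  · simp [he₁]
  · rw [hf₁, show f - (u₂ : G) - u₃ - f = -(u₂ + u₃) by abel]
    exact A.neg_mem (A.add_mem u₂.2 u₃.2)

lemma IsSl2TripleMod.congr {A : LieIdeal K G} {h e f h' e' f' : G} (t : IsSl2TripleMod A h e f)
    (hh : h' - h ∈ A) (he : e' - e ∈ A) (hf : f' - f ∈ A) : IsSl2TripleMod A h' e' f' := by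
  obtain ⟨u, hu, rfl⟩ : ∃ u ∈ A, h' = h + u := ⟨_, hh, by abel⟩
  obtain ⟨v, hv, rfl⟩ : ∃ u ∈ A, e' = e + u := ⟨_, he, by abel⟩
  obtain ⟨w, hw, rfl⟩ : ∃ u ∈ A, f' = f + u := ⟨_, hf, by abel⟩
  have hr (x : G) {a : G} (ha : a ∈ A) : ⁅x, a⁆ ∈ A := lie_mem_right K G A x a ha
  have hl (x : G) {a : G} (ha : a ∈ A) : ⁅a, x⁆ ∈ A := lie_mem_left K G A a x ha
  obtain ⟨h1, h2, h3⟩ := t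
  refine ⟨?_, ?_, ?_⟩
  · rw [show ⁅h + u, e + v⁆ - (2 : K) • (e + v)
      = (⁅h, e⁆ - (2 : K) • e) + (⁅h, v⁆ + ⁅u, e + v⁆ - (2 : K) • v) by
        simp only [add_lie, lie_add, smul_add]; abel]
    exact A.add_mem h1 (A.sub_mem (A.add_mem (hr _ hv) (hl _ hu)) (A.smul_mem _ hv))
  · rw [show ⁅h + u, f + w⁆ + (2 : K) • (f + w)
      = (⁅h, f⁆ + (2 : K) • f) + (⁅h, w⁆ + ⁅u, f + w⁆ + (2 : K) • w) by
        simp only [add_lie, lie_add, smul_add]; abel]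
    exact A.add_mem h2 (A.add_mem (A.add_mem (hr _ hw) (hl _ hu)) (A.smul_mem _ hw))
  · rw [show ⁅e + v, f + w⁆ - (h + u) = (⁅e, f⁆ - h) + (⁅e, w⁆ + ⁅v, f + w⁆ - u) by
        simp only [add_lie, lie_add]; abel]
    exact A.add_mem h3 (A.sub_mem (A.add_mem (hr _ hw) (hl _ hv)) hu)

/-- Lifting a triple inside a Lie subalgebra. -/
lemma IsSl2TripleMod.exists_of_subalgebra {A : LieIdeal K G} {h e f : G}
    (t : IsSl2TripleMod A h e f) (T : LieSubalgebra K G) (hh : h ∈ T) (he : e ∈ T) (hf : f ∈ T)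
    (hT : IsSl2TripleMod (A.comap T.incl) (⟨h, hh⟩ : T) ⟨e, he⟩ ⟨f, hf⟩ →
      ∃ h' e' f' : T, IsSl2TripleMod (⊥ : LieIdeal K T) h' e' f' ∧
        h' - ⟨h, hh⟩ ∈ A.comap T.incl ∧ e' - ⟨e, he⟩ ∈ A.comap T.incl ∧
        f' - ⟨f, hf⟩ ∈ A.comap T.incl) :
    ∃ h' e' f' : G, IsSl2TripleMod (⊥ : LieIdeal K G) h' e' f' ∧
      h' - h ∈ A ∧ e' - e ∈ A ∧ f' - f ∈ A := by
  obtain ⟨h', e', f', ⟨h1, h2, h3⟩, ha, hb, hc⟩ := hT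
    ⟨by rw [LieIdeal.mem_comap]; exact t.lie_h_e, by rw [LieIdeal.mem_comap]; exact t.lie_h_f,
      by rw [LieIdeal.mem_comap]; exact t.lie_e_f⟩
  rw [LieIdeal.mem_comap] at ha hb hc
  rw [LieSubmodule.mem_bot] at h1 h2 h3
  refine ⟨h', e', f', ⟨?_, ?_, ?_⟩, ha, hb, hc⟩
  · simpa using congrArg Subtype.val h1
  · simpa using congrArg Subtype.val h2
  · simpa using congrArg Subtype.val h3

/-- Lifting a triple along a surjective homomorphism. -/
lemma IsSl2TripleMod.exists_of_surjective {G' : Type*} [LieRing G'] [LieAlgebra K G']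
    {A : LieIdeal K G} {h e f : G} (φ : G →ₗ⁅K⁆ G') (hφ : Function.Surjective φ)
    {A' : LieIdeal K G'} (hA : A'.comap φ = A)
    (H : ∃ h' e' f' : G', IsSl2TripleMod (⊥ : LieIdeal K G') h' e' f' ∧
      h' - φ h ∈ A' ∧ e' - φ e ∈ A' ∧ f' - φ f ∈ A') :
    ∃ h' e' f' : G, IsSl2TripleMod φ.ker h' e' f' ∧ h' - h ∈ A ∧ e' - e ∈ A ∧ f' - f ∈ A := by
  obtain ⟨h', e', f', ⟨h1, h2, h3⟩, ha, hb, hc⟩ := H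
  obtain ⟨h', rfl⟩ := hφ h'
  obtain ⟨e', rfl⟩ := hφ e'
  obtain ⟨f', rfl⟩ := hφ f'
  rw [LieSubmodule.mem_bot] at h1 h2 h3
  refine ⟨h', e', f', ⟨?_, ?_, ?_⟩, ?_, ?_, ?_⟩
  · rw [LieHom.mem_ker]; simpa using h1
  · rw [LieHom.mem_ker]; simpa using h2
  · rw [LieHom.mem_ker]; simpa using h3
  all_goals rw [← hA, LieIdeal.mem_comap]; simpa

lemma IsSl2TripleMod.map {G' : Type*} [LieRing G'] [LieAlgebra K G'] {A : LieIdeal K G}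
    {h e f : G} (t : IsSl2TripleMod A h e f) (φ : G →ₗ⁅K⁆ G') {A' : LieIdeal K G'}
    (hA : A ≤ A'.comap φ) : IsSl2TripleMod A' (φ h) (φ e) (φ f) := by
  refine ⟨?_, ?_, ?_⟩
  · simpa [LieIdeal.mem_comap] using hA t.lie_h_e
  · simpa [LieIdeal.mem_comap] using hA t.lie_h_f
  · simpa [LieIdeal.mem_comap] using hA t.lie_e_f

/-- The projection onto a quotient Lie algebra, as a homomorphism of Lie algebras. -/
def quotientLieHom (A : LieIdeal K G) : G →ₗ⁅K⁆ G ⧸ A :=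
  { (LieSubmodule.Quotient.mk' A : G →ₗ[K] G ⧸ A) with
    map_lie' := fun {x y} ↦ LieSubmodule.Quotient.mk_bracket (I := A) x y }

lemma quotientLieHom_surjective (A : LieIdeal K G) : Function.Surjective (quotientLieHom A) :=
  LieSubmodule.Quotient.surjective_mk' A

lemma quotientLieHom_eq_zero {A : LieIdeal K G} {x : G} : quotientLieHom A x = 0 ↔ x ∈ A :=
  LieSubmodule.Quotient.mk_eq_zero'

lemma ker_quotientLieHom (A : LieIdeal K G) : (quotientLieHom A).ker = A := by
  ext x
  rw [LieHom.mem_ker, quotientLieHom_eq_zero]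

lemma comap_map_quotientLieHom {A A' : LieIdeal K G} (h : A' ≤ A) :
    (A.map (quotientLieHom A')).comap (quotientLieHom A') = A := by
  rw [LieIdeal.comap_map_eq, ker_quotientLieHom, sup_eq_left.mpr h]
  exact congrArg (fun S : Submodule K (G ⧸ A') ↦ (S : Set (G ⧸ A')))
    (LieIdeal.coe_map_of_surjective (quotientLieHom_surjective A'))

lemma IsSl2TripleMod.trans {A A' : LieIdeal K G} (hA : A' ≤ A) {h e f : G}
    (H : ∃ h' e' f' : G, IsSl2TripleMod A' h' e' f' ∧ h' - h ∈ A ∧ e' - e ∈ A ∧ f' - f ∈ A)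
    (H' : LiftsSl2Triples A' ⊥) :
    ∃ h' e' f' : G, IsSl2TripleMod (⊥ : LieIdeal K G) h' e' f' ∧
      h' - h ∈ A ∧ e' - e ∈ A ∧ f' - f ∈ A := by
  obtain ⟨h', e', f', t', ha, hb, hc⟩ := H
  obtain ⟨h'', e'', f'', t'', ha', hb', hc'⟩ := H' h' e' f' t'
  refine ⟨h'', e'', f'', t'', ?_, ?_, ?_⟩
  · simpa using A.add_mem (hA ha') ha
  · simpa using A.add_mem (hA hb') hb
  · simpa using A.add_mem (hA hc') hc

lemma mem_sup_engel [FiniteDimensional K G] {A : LieIdeal K G} {a : G} (ha : a ∈ A) (x : G) :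
    ∃ y ∈ LieSubalgebra.engel K a, y - x ∈ A := by
  obtain ⟨k, hk⟩ := Filter.eventually_atTop.mp
    (LieAlgebra.ad K G a).eventually_codisjoint_ker_pow_range_pow
  obtain ⟨y, hy, z, ⟨z, rfl⟩, rfl⟩ := Submodule.mem_sup.mp
    ((hk (k + 1) k.le_succ).eq_top.symm ▸ Submodule.mem_top (x := x))
  refine ⟨y, (LieSubalgebra.mem_engel_iff K a y).mpr ⟨_, hy⟩, ?_⟩
  rw [show y - (y + (ad K G a ^ (k + 1)) z) = -(ad K G a ^ (k + 1)) z by abel, pow_succ',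
    Module.End.mul_apply, LieAlgebra.ad_apply]
  exact A.neg_mem (lie_mem_left K G A a _ ha)

lemma lie_ne_self_of_forall_engel [FiniteDimensional K G] {A : LieIdeal K G} (hA : A ≠ ⊥)
    (h : ∀ a ∈ A, LieSubalgebra.engel K a = ⊤) : ⁅A, A⁆ ≠ A := by
  intro hAA
  have hnil : LieModule.IsNilpotent A G := by
    rw [LieModule.isNilpotent_iff_forall (R := K)]
    intro a
    rw [Module.End.isNilpotent_iff_of_finite]
    intro x
    exact (LieSubalgebra.mem_engel_iff K (a : G) x).mp (h a a.2 ▸ LieSubalgebra.mem_top x)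
  obtain ⟨k, hk⟩ := (LieModule.isNilpotent_iff K A G).mp hnil
  refine hA ((LieSubmodule.eq_bot_iff _).mpr fun x hx ↦ ?_)
  have key : ∀ k, ∀ x ∈ A, x ∈ LieModule.lowerCentralSeries K A G k := by
    intro k
    induction k with
    | zero => simp
    | succ k ih =>
      intro x hx
      rw [← hAA, ← LieSubmodule.mem_toSubmodule, LieSubmodule.lieIdeal_oper_eq_linear_span'] at hx
      rw [LieModule.lowerCentralSeries_succ]
      refine Submodule.span_le.mpr ?_ hx
      rintro _ ⟨a, ha, b, hb, rfl⟩
      exact LieSubmodule.lie_mem_lie (x := (⟨a, ha⟩ : A)) (LieSubmodule.mem_top _) (ih b hb)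
  simpa [hk] using key k x hx

lemma finrank_comap_incl (A : LieIdeal K G) (T : LieSubalgebra K G) :
    finrank K (A.comap T.incl) = finrank K (A.toSubmodule ⊓ T.toSubmodule : Submodule K G) := by
  let N : Submodule K T := (A.comap T.incl).toSubmodule
  have : A.toSubmodule ⊓ T.toSubmodule = N.map T.toSubmodule.subtype := by
    ext x
    refine ⟨fun hx ↦ ⟨⟨x, hx.2⟩, hx.1, rfl⟩, ?_⟩
    rintro ⟨x, hx, rfl⟩
    exact ⟨hx, x.2⟩
  rw [this, Submodule.finrank_map_subtype_eq T.toSubmodule N]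
  rfl

lemma finrank_comap_engel_lt [FiniteDimensional K G] {A : LieIdeal K G} {a : G} (ha : a ∈ A)
    (hne : LieSubalgebra.engel K a ≠ ⊤) :
    finrank K (A.comap (LieSubalgebra.engel K a).incl) < finrank K A := by
  set T := LieSubalgebra.engel K a
  refine (finrank_comap_incl A T).trans_lt
    (Submodule.finrank_lt_finrank_of_lt (t := A.toSubmodule) ?_)
  refine lt_of_le_of_ne inf_le_left fun heq ↦ hne ?_
  rw [eq_top_iff]
  intro x _
  obtain ⟨y, hy, hyx⟩ := mem_sup_engel ha x
  simpa using T.sub_mem hy (inf_eq_left.mp heq hyx)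

lemma functional_map_eq_zero {G' : Type*} [LieRing G'] [LieAlgebra K G'] {A : LieIdeal K G}
    (hA : ⁅(⊤ : LieIdeal K G), A⁆ = A) {h e f : G}
    (hs : ∀ x : G, x ∈ Submodule.span K {h, e, f} ⊔ A.toSubmodule) (φ : G →ₗ⁅K⁆ G')
    (hφ : Function.Surjective φ) (hA' : ∀ a ∈ A, ∀ b ∈ A, φ ⁅a, b⁆ = 0) (ξ : Dual K (A.map φ))
    (he : ∀ a : A.map φ, ξ ⁅φ e, a⁆ = 0) (hh : ∀ a : A.map φ, ξ ⁅φ h, a⁆ = 0)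
    (hf : ∀ a : A.map φ, ξ ⁅φ f, a⁆ = 0) : ξ = 0 := by
  let η : A →ₗ[K] K := ξ ∘ₗ (φ : G →ₗ[K] G').restrict
    (p := A.toSubmodule) (q := (A.map φ).toSubmodule) fun x hx ↦ LieIdeal.mem_map hx
  have hη (a : A) : η a = ξ ⟨φ a, LieIdeal.mem_map a.2⟩ := rfl
  have hlie (x : G) (a : A) : η ⁅x, a⁆ = ξ ⁅φ x, (⟨φ a, LieIdeal.mem_map a.2⟩ : A.map φ)⁆ := by
    rw [hη]
    exact congrArg ξ (Subtype.ext (φ.map_lie x a))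
  let S : Submodule K G :=
    { carrier := {x | ∀ a : A, η ⁅x, a⁆ = 0}
      add_mem' := fun hx hy a ↦ by rw [add_lie, map_add, hx a, hy a, add_zero]
      zero_mem' := fun a ↦ by rw [zero_lie, map_zero]
      smul_mem' := fun c x hx a ↦ by rw [smul_lie, map_smul, hx a, smul_zero] }
  have htop (x : G) : x ∈ S := by
    refine (sup_le (Submodule.span_le.mpr ?_) ?_ : _ ≤ S) (hs x)
    · rintro y (rfl | rfl | rfl) a <;> rw [hlie]
      exacts [hh _, he _, hf _]
    · intro y hy a
      have : (⟨φ (⁅y, a⁆ : A), LieIdeal.mem_map (⁅y, a⁆ : A).2⟩ : A.map φ) = 0 :=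
        Subtype.ext (hA' y hy a a.2)
      rw [hη, this, map_zero]
  have hker : A.toSubmodule ≤ (LinearMap.ker η).map A.toSubmodule.subtype := by
    conv_lhs => rw [← hA, LieSubmodule.lieIdeal_oper_eq_linear_span']
    refine Submodule.span_le.mpr ?_
    rintro _ ⟨x, -, a, ha, rfl⟩
    exact ⟨(⁅x, (⟨a, ha⟩ : A)⁆ : A), htop x ⟨a, ha⟩, rfl⟩
  ext ⟨y, hy⟩
  obtain ⟨⟨a, ha⟩, rfl⟩ := LieIdeal.mem_map_of_surjective hφ hy
  obtain ⟨b, hb, hba⟩ := hker ha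
  obtain rfl : b = ⟨a, ha⟩ := Subtype.ext hba
  exact hb

/-- The subalgebra spanned by an ideal and a triple satisfying the `sl₂` relations modulo it. -/
def IsSl2TripleMod.subalgebra {A : LieIdeal K G} {h e f : G} (t : IsSl2TripleMod A h e f) :
    LieSubalgebra K G where
  toSubmodule := Submodule.span K {h, e, f} ⊔ A.toSubmodule
  lie_mem' := by
    intro x y hx hy
    set W := Submodule.span K {h, e, f} ⊔ A.toSubmodule with hW
    have hA : A.toSubmodule ≤ W := le_sup_right
    have hspan : Submodule.span K {h, e, f} ≤ W := le_sup_left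
    have mh : h ∈ W := hspan (Submodule.subset_span (by simp))
    have me : e ∈ W := hspan (Submodule.subset_span (by simp))
    have mf : f ∈ W := hspan (Submodule.subset_span (by simp))
    have h1 : ⁅h, e⁆ ∈ W := by
      simpa using W.add_mem (hA t.lie_h_e) (W.smul_mem (2 : K) me)
    have h2 : ⁅h, f⁆ ∈ W := by
      simpa using W.sub_mem (hA t.lie_h_f) (W.smul_mem (2 : K) mf)
    have h3 : ⁅e, f⁆ ∈ W := by simpa using W.add_mem (hA t.lie_e_f) mh
    have swap {x y : G} (hxy : ⁅x, y⁆ ∈ W) : ⁅y, x⁆ ∈ W := by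
      rw [← lie_skew]; exact W.neg_mem hxy
    obtain ⟨s, hs, a, ha, rfl⟩ := Submodule.mem_sup.mp hx
    obtain ⟨s', hs', a', ha', rfl⟩ := Submodule.mem_sup.mp hy
    obtain ⟨p, q, r, rfl⟩ := Submodule.mem_span_triple.mp hs
    obtain ⟨p', q', r', rfl⟩ := Submodule.mem_span_triple.mp hs'
    have hr (x : G) {a : G} (ha : a ∈ A) : ⁅x, a⁆ ∈ W := hA (lie_mem_right K G A x a ha)
    have hl (x : G) {a : G} (ha : a ∈ A) : ⁅a, x⁆ ∈ W := hA (lie_mem_left K G A a x ha)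
    change ⁅_, _⁆ ∈ W
    simp only [add_lie (p • h + q • e + r • f) a, lie_add (p • h + q • e + r • f) _ a']
    refine W.add_mem (W.add_mem ?_ (hr _ ha')) (hl _ ha)
    simp only [add_lie, lie_add, smul_lie, lie_smul, lie_self]
    have := swap h1
    have := swap h2
    have := swap h3
    repeat' first | apply W.add_mem | apply W.smul_mem | assumption | exact W.zero_mem

theorem liftsSl2Triples_bot.{u} {K : Type*} [Field K] [CharZero K] (n : ℕ) :
    ∀ (G : Type u) [LieRing G] [LieAlgebra K G] [FiniteDimensional K G] (A : LieIdeal K G),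
      finrank K A ≤ n → LiftsSl2Triples A ⊥ := by
  induction n using Nat.strong_induction_on with
  | _ n ih =>
  have spanned : ∀ (G : Type u) [LieRing G] [LieAlgebra K G] [FiniteDimensional K G]
      (A : LieIdeal K G), finrank K A ≤ n → ∀ h e f : G, IsSl2TripleMod A h e f →
      (∀ x : G, x ∈ Submodule.span K {h, e, f} ⊔ A.toSubmodule) →
      ∃ h' e' f' : G, IsSl2TripleMod (⊥ : LieIdeal K G) h' e' f' ∧
        h' - h ∈ A ∧ e' - e ∈ A ∧ f' - f ∈ A := by
    intro G _ _ _ A hn h e f t hs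
    by_cases hbot : A = ⊥
    · subst hbot
      exact ⟨h, e, f, t, by simp⟩
    have ih' (A' : LieIdeal K G) (hA' : A' < A) : LiftsSl2Triples A' ⊥ :=
      ih (finrank K A') ((Submodule.finrank_lt_finrank_of_lt (s := A'.toSubmodule)
        (t := A.toSubmodule) hA').trans_le hn) G A' le_rfl
    by_cases heng : ∀ a ∈ A, LieSubalgebra.engel K a = ⊤
    · by_cases htop : ⁅(⊤ : LieIdeal K G), A⁆ = A
      · have hlt : ⁅A, A⁆ < A :=
          lt_of_le_of_ne (LieSubmodule.lie_le_right _ _) (lie_ne_self_of_forall_engel hbot heng)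
        refine IsSl2TripleMod.trans hlt.le ?_ (ih' _ hlt)
        have := IsSl2TripleMod.exists_of_surjective (quotientLieHom ⁅A, A⁆)
          (quotientLieHom_surjective _) (comap_map_quotientLieHom hlt.le) (h := h) (e := e) (f := f)
          (exists_sl2TripleMod_bot_of_abelian ?_ (t.map _ (comap_map_quotientLieHom hlt.le).ge)
            (functional_map_eq_zero htop hs _ (quotientLieHom_surjective _)
              fun a ha b hb ↦ quotientLieHom_eq_zero.mpr (LieSubmodule.lie_mem_lie ha hb)))
        · rwa [ker_quotientLieHom] at this
        intro a ha b hb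
        obtain ⟨a, rfl⟩ := LieIdeal.mem_map_of_surjective (quotientLieHom_surjective _) ha
        obtain ⟨b, rfl⟩ := LieIdeal.mem_map_of_surjective (quotientLieHom_surjective _) hb
        rw [← LieHom.map_lie, quotientLieHom_eq_zero]
        exact LieSubmodule.lie_mem_lie a.2 b.2
      · have hlt : ⁅(⊤ : LieIdeal K G), A⁆ < A :=
          lt_of_le_of_ne (LieSubmodule.lie_le_right _ _) htop
        refine IsSl2TripleMod.trans hlt.le ?_ (ih' _ hlt)
        have := IsSl2TripleMod.exists_of_surjective (quotientLieHom ⁅(⊤ : LieIdeal K G), A⁆)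
          (quotientLieHom_surjective _) (comap_map_quotientLieHom hlt.le) (h := h) (e := e) (f := f)
          (exists_sl2TripleMod_bot_of_central ?_ _ _ _
            (t.map _ (comap_map_quotientLieHom hlt.le).ge))
        · rwa [ker_quotientLieHom] at this
        intro x a ha
        obtain ⟨x, rfl⟩ := quotientLieHom_surjective _ x
        obtain ⟨a, rfl⟩ := LieIdeal.mem_map_of_surjective (quotientLieHom_surjective _) ha
        rw [← LieHom.map_lie, quotientLieHom_eq_zero]
        exact LieSubmodule.lie_mem_lie (LieSubmodule.mem_top x) a.2
    · push Not at heng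
      obtain ⟨a, ha, hne⟩ := heng
      obtain ⟨h₀, hh, hh'⟩ := mem_sup_engel ha h
      obtain ⟨e₀, he, he'⟩ := mem_sup_engel ha e
      obtain ⟨f₀, hf, hf'⟩ := mem_sup_engel ha f
      obtain ⟨h', e', f', t', ha', hb', hc'⟩ := (t.congr hh' he' hf').exists_of_subalgebra
        (LieSubalgebra.engel K a) hh he hf
        (ih _ ((finrank_comap_engel_lt ha hne).trans_le hn) (LieSubalgebra.engel K a) _ le_rfl
          _ _ _)
      refine ⟨h', e', f', t', ?_, ?_, ?_⟩
      · simpa using A.add_mem ha' hh'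
      · simpa using A.add_mem hb' he'
      · simpa using A.add_mem hc' hf'
  intro G _ _ _ A hn h e f t
  have hmem (x : G) (hx : x ∈ ({h, e, f} : Set G)) : x ∈ t.subalgebra :=
    Submodule.mem_sup_left (Submodule.subset_span hx)
  refine t.exists_of_subalgebra t.subalgebra (hmem h (by simp)) (hmem e (by simp))
    (hmem f (by simp)) fun t' ↦ spanned t.subalgebra _ ?_ _ _ _ t' ?_
  · exact ((finrank_comap_incl A t.subalgebra).trans_le
      (Submodule.finrank_mono (t := A.toSubmodule) inf_le_left)).trans hn
  · rintro ⟨x, hx⟩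
    obtain ⟨s, hs, a, ha, rfl⟩ := Submodule.mem_sup.mp hx
    obtain ⟨p, q, r, rfl⟩ := Submodule.mem_span_triple.mp hs
    exact Submodule.mem_sup.mpr ⟨_, Submodule.mem_span_triple.mpr ⟨p, q, r, rfl⟩,
      ⟨a, Submodule.mem_sup_right ha⟩, LieIdeal.mem_comap.mpr ha, rfl⟩

end Lifting

section InvariantForm

open LieAlgebra LieAlgebra.InvariantForm LieAlgebra.IsKilling LieModule Module

variable {K L : Type*} [Field K] [CharZero K] [LieRing L] [LieAlgebra K L] [FiniteDimensional K L]

/-- An invariant form on a semisimple Lie algebra is zero as soon as `Φ e f = 0` for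
every `sl₂` triple. -/
theorem eq_zero_of_lieInvariant_of_sl2 [IsAlgClosed K] [IsKilling K L]
    (Φ : LinearMap.BilinForm K L) (hΦ : Φ.lieInvariant L)
    (hsl2 : ∀ h e f, IsSl2Triple h e f → Φ e f = 0) : Φ = 0 := by
  obtain ⟨u, hu⟩ := LieAlgebra.exists_isCartanSubalgebra_engel K L
  set H := LieSubalgebra.engel K u
  have span (p : Submodule K L) (hp : ∀ α : Weight K H L, ∀ x ∈ rootSpace H α, x ∈ p) (x : L) :
      x ∈ p := by
    have : (⨆ α : Weight K H L, rootSpace H α).toSubmodule ≤ p := by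
      rw [LieSubmodule.iSup_toSubmodule]
      exact iSup_le hp
    exact this (iSup_genWeightSpace_eq_top' K H L ▸ LieSubmodule.mem_top x)
  have hroot (α : Weight K H L) (hα : α.IsNonZero) (x : L) (hx : x ∈ rootSpace H α) : Φ x = 0 := by
    refine LinearMap.ext (span (LinearMap.ker (Φ x)) fun β y hy ↦ ?_)
    rw [LinearMap.mem_ker]
    by_cases hαβ : β = -α
    · subst hαβ
      obtain ⟨h, e, f, t, he, hf⟩ := exists_isSl2Triple_of_weight_isNonZero hα
      obtain ⟨c, hc⟩ := (finrank_eq_one_iff_of_nonzero' (⟨e, he⟩ : rootSpace H α)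
        (by simpa using t.e_ne_zero)).mp (finrank_rootSpace_eq_one α hα) ⟨x, hx⟩
      obtain ⟨d, hd⟩ := (finrank_eq_one_iff_of_nonzero' (⟨f, hf⟩ : rootSpace H (-α : Weight K H L))
        (by simpa using t.f_ne_zero)).mp (finrank_rootSpace_eq_one (-α)
          (Weight.isNonZero_neg.mpr hα)) ⟨y, hy⟩
      have hc' : c • e = x := congrArg Subtype.val hc
      have hd' : d • f = y := congrArg Subtype.val hd
      rw [← hc', ← hd', map_smul, map_smul, LinearMap.smul_apply, hsl2 h e f t, smul_zero,
        smul_zero]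
    · obtain ⟨h, hh⟩ : ∃ h, α h + β h ≠ 0 := by
        by_contra! hcon
        exact hαβ (Weight.ext fun h ↦ by
          simpa using (neg_eq_of_add_eq_zero_right (hcon h)).symm)
      have := hΦ (h : L) x y
      rw [← LieSubalgebra.coe_bracket_of_module, ← LieSubalgebra.coe_bracket_of_module,
        lie_eq_smul_of_mem_rootSpace hx, lie_eq_smul_of_mem_rootSpace hy] at this
      have : (α h + β h) * Φ x y = 0 := by
        rw [add_mul, add_eq_zero_iff_eq_neg]
        simpa using this
      exact (mul_eq_zero.mp this).resolve_left hh
  have hcoroot (α : Weight K H L) (hα : α.IsNonZero) : Φ (coroot α : H) = 0 := by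
    obtain ⟨h, e, f, t, he, hf⟩ := exists_isSl2Triple_of_weight_isNonZero hα
    ext z
    rw [← t.h_eq_coroot hα he hf, ← t.lie_e_f, hΦ, hroot (-α) (Weight.isNonZero_neg.mpr hα) f hf]
    simp
  refine LinearMap.ext (span (LinearMap.ker Φ) fun α x hx ↦ ?_)
  rw [LinearMap.mem_ker]
  by_cases hα : α.IsNonZero
  · exact hroot α hα x hx
  · have hα0 : (α : H → K) = 0 := not_not.mp hα
    rw [hα0, rootSpace_zero_eq, LieSubalgebra.mem_toLieSubmodule] at hx
    have : (⊤ : Submodule K H) ≤ LinearMap.ker (Φ ∘ₗ H.toSubmodule.subtype) := by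
      rw [← RootPairing.IsRootSystem.span_coroot_eq_top (P := rootSystem H), Submodule.span_le]
      rintro _ ⟨β, rfl⟩
      rw [rootSystem_coroot_apply]
      exact hcoroot β (LieSubalgebra.isNonZero_coe_root β)
    exact this (Submodule.mem_top (x := (⟨x, hx⟩ : H)))

instance hasTrivialRadical_quotient_radical : HasTrivialRadical K (L ⧸ radical K L) := by
  rw [hasTrivialRadical_iff_no_abelian_ideals]
  intro J hJ
  set φ := quotientLieHom (radical K L)
  have hab : ⁅J.comap φ, J.comap φ⁆ ≤ radical K L := by
    rw [LieSubmodule.lie_le_iff]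
    intro x hx y hy
    rw [← quotientLieHom_eq_zero, LieHom.map_lie]
    exact congrArg Subtype.val
      (hJ.trivial ⟨φ x, LieIdeal.mem_comap.mp hx⟩ ⟨φ y, LieIdeal.mem_comap.mp hy⟩)
  have hsolv : IsSolvable (J.comap φ) := by
    obtain ⟨k, hk⟩ := IsSolvable.solvable K (radical K L)
    rw [LieIdeal.derivedSeries_eq_bot_iff] at hk
    refine IsSolvable.mk (k := k + 1) (R := K) ?_
    rw [LieIdeal.derivedSeries_eq_bot_iff, derivedSeriesOfIdeal_add, derivedSeriesOfIdeal_succ,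
      derivedSeriesOfIdeal_zero, eq_bot_iff, ← hk]
    exact derivedSeriesOfIdeal_mono hab k
  rw [LieIdeal.solvable_iff_le_radical] at hsolv
  refine (LieSubmodule.eq_bot_iff _).mpr fun x hx ↦ ?_
  obtain ⟨x, rfl⟩ := quotientLieHom_surjective _ x
  exact quotientLieHom_eq_zero.mpr (hsolv (LieIdeal.mem_comap.mpr hx))

/-- Let `s` be a nondegenerate invariant form on `L`, and `p : G → L` a surjection such that
`s (p h) (p h) = 0` for every `sl₂` triple `h`, `e`, `f` in `G`. Then the orthogonal of the radical
of `L` is contained in the radical. -/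
theorem orthogonal_radical_le.{u} [IsAlgClosed K] {G : Type u} [LieRing G] [LieAlgebra K G]
    [FiniteDimensional K G] (s : LinearMap.BilinForm K L) (hs : s.lieInvariant L)
    (hsymm : ∀ x y, s x y = s y x) (hnd : ∀ x, (∀ y, s x y = 0) → x = 0)
    (p : G →ₗ⁅K⁆ L) (hp : Function.Surjective p)
    (hsl2 : ∀ h e f : G, IsSl2TripleMod (⊥ : LieIdeal K G) h e f → s (p h) (p h) = 0) :
    orthogonal s hs (radical K L) ≤ radical K L := by
  set b := radical K L with hb
  set N : LieIdeal K L := orthogonal s hs b with hN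
  set φ := quotientLieHom b with hφ
  have hφs : Function.Surjective φ := quotientLieHom_surjective b
  by_contra hNb
  have hmap : LieIdeal.map φ N ≠ ⊥ := by rwa [Ne, LieIdeal.map_eq_bot_iff, ker_quotientLieHom]
  obtain ⟨I, hI, hIN⟩ := (eq_bot_or_exists_atom_le (LieIdeal.map φ N)).resolve_left hmap
  have hsimple : IsSimple K I := IsSemisimple.isSimple_of_isAtom I hI
  obtain ⟨τ, hτ⟩ : ∃ τ : I →ₗ[K] L, ∀ x : I, φ (τ x) = x ∧ τ x ∈ N := by
    let ψ : (N ⊓ LieIdeal.comap φ I : LieIdeal K L) →ₗ[K] I := (φ : L →ₗ[K] L ⧸ b).restrict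
      (p := (N ⊓ LieIdeal.comap φ I).toSubmodule) (q := I.toSubmodule) fun x hx ↦
        LieIdeal.mem_comap.mp hx.2
    obtain ⟨σ, hσ⟩ := ψ.exists_rightInverse_of_surjective (LinearMap.range_eq_top.mpr (by
      rintro ⟨y, hy⟩
      obtain ⟨⟨x, hx⟩, rfl⟩ := LieIdeal.mem_map_of_surjective hφs (hIN hy)
      exact ⟨⟨x, hx, LieIdeal.mem_comap.mpr hy⟩, rfl⟩))
    refine ⟨(N ⊓ LieIdeal.comap φ I).toSubmodule.subtype ∘ₗ σ, fun x ↦ ⟨?_, (σ x).2.1⟩⟩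
    exact congrArg Subtype.val (LinearMap.congr_fun hσ x)
  have hz {x y : L} (hx : x ∈ b) (hy : y ∈ N) : s x y = 0 := (mem_orthogonal s hs b y).mp hy x hx
  have hcongr {x x' y y' : L} (hx : φ x = φ x') (hy : φ y = φ y') (hx' : x' ∈ N) (hyN : y ∈ N) :
      s x y = s x' y' := by
    have h1 : x - x' ∈ b := by rw [← quotientLieHom_eq_zero, map_sub, sub_eq_zero]; exact hx
    have h2 : y - y' ∈ b := by rw [← quotientLieHom_eq_zero, map_sub, sub_eq_zero]; exact hy
    have e1 := hz h1 hyN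
    have e2 := hz h2 hx'
    rw [map_sub, LinearMap.sub_apply, sub_eq_zero] at e1
    rw [hsymm, map_sub, sub_eq_zero] at e2
    exact e1.trans e2
  have hNl (x : L) {y : L} (hy : y ∈ N) : ⁅x, y⁆ ∈ N := lie_mem_right K L N x y hy
  have hlie (x y : I) : φ (τ ⁅x, y⁆) = φ ⁅τ x, τ y⁆ := by
    rw [(hτ _).1, φ.map_lie, (hτ x).1, (hτ y).1]; rfl
  have hzero : s.compl₁₂ τ τ = 0 := by
    refine eq_zero_of_lieInvariant_of_sl2 _ (fun x y z ↦ ?_) fun h e f t ↦ ?_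
    · simp only [LinearMap.compl₁₂_apply]
      rw [hcongr (hlie x y) rfl (hNl _ (hτ y).2) (hτ z).2, hs,
        hcongr rfl (hlie x z) (hτ y).2 (hτ _).2]
    · rw [LinearMap.compl₁₂_apply]
      obtain ⟨h₀, hh₀⟩ := hp (τ h)
      obtain ⟨e₀, he₀⟩ := hp (τ e)
      obtain ⟨f₀, hf₀⟩ := hp (τ f)
      have hbN {x : L} (hx : x ∈ N) (hx' : φ x = 0) : x ∈ b ⊓ N :=
        ⟨quotientLieHom_eq_zero.mp hx', hx⟩
      have t₀ : IsSl2TripleMod (LieIdeal.comap p (b ⊓ N)) h₀ e₀ f₀ := by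
        refine ⟨?_, ?_, ?_⟩ <;> rw [LieIdeal.mem_comap] <;>
          simp only [map_sub, map_add, map_smul, p.map_lie, hh₀, he₀, hf₀]
        · refine hbN (N.sub_mem (hNl _ (hτ e).2) (N.smul_mem _ (hτ e).2)) ?_
          rw [map_sub, ← hlie, t.lie_h_e_nsmul, two_nsmul, two_smul, map_add τ, sub_self]
        · refine hbN (N.add_mem (hNl _ (hτ f).2) (N.smul_mem _ (hτ f).2)) ?_
          rw [map_add, ← hlie, t.lie_h_f_nsmul, two_nsmul, two_smul, map_neg τ, map_add τ,
            map_neg φ, neg_add_cancel]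
        · refine hbN (N.sub_mem (hNl _ (hτ f).2) (hτ h).2) ?_
          rw [map_sub, ← hlie, t.lie_e_f, sub_self]
      obtain ⟨H, E, F, T, hH, hE, hF⟩ := liftsSl2Triples_bot _ G _ le_rfl h₀ e₀ f₀ t₀
      have hEF : ⁅E, F⁆ = H := sub_eq_zero.mp ((LieSubmodule.mem_bot _).mp T.lie_e_f)
      have hHE : ⁅H, E⁆ = (2 : K) • E := sub_eq_zero.mp ((LieSubmodule.mem_bot _).mp T.lie_h_e)
      have h0 := hsl2 H E F T
      nth_rw 1 [← hEF] at h0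
      rw [p.map_lie, hs, ← lie_skew, ← p.map_lie, hHE, map_neg, neg_neg, map_smul, map_smul,
        smul_eq_mul, mul_eq_zero_iff_left two_ne_zero, hsymm] at h0
      rw [LieIdeal.mem_comap, map_sub] at hE hF
      rw [he₀] at hE
      rw [hf₀] at hF
      rw [← h0]
      refine hcongr ?_ ?_ ?_ (hτ f).2
      · rw [eq_comm, ← sub_eq_zero, ← map_sub]; exact quotientLieHom_eq_zero.mpr hE.1
      · rw [eq_comm, ← sub_eq_zero, ← map_sub]; exact quotientLieHom_eq_zero.mpr hF.1
      · simpa using N.add_mem hE.2 (hτ e).2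
  have hiso {x y : L} (hx : x ∈ N) (hx' : φ x ∈ I) (hy : y ∈ N) (hy' : φ y ∈ I) : s x y = 0 := by
    rw [hcongr (x' := τ ⟨φ x, hx'⟩) (y' := τ ⟨φ y, hy'⟩) (hτ ⟨φ x, hx'⟩).1.symm
      (hτ ⟨φ y, hy'⟩).1.symm (hτ _).2 hy]
    exact LinearMap.congr_fun₂ hzero _ _
  refine hsimple.non_abelian ⟨fun x y ↦ Subtype.ext ?_⟩
  have : ⁅τ x, τ y⁆ = 0 := by
    refine hnd _ fun z ↦ ?_
    rw [hs, hiso (hτ y).2 ((hτ y).1.symm ▸ y.2) (lie_mem_left K L N _ _ (hτ x).2), neg_zero]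
    rw [φ.map_lie, (hτ x).1]
    exact lie_mem_left K _ I _ _ x.2
  rw [← (hτ _).1, hlie, this, map_zero]
  rfl

end InvariantForm

section MaximalIsotropic

open LieAlgebra LieAlgebra.InvariantForm LieModule

variable {K : Type*} [Field K] [CharZero K] [IsAlgClosed K]

/-- Lie's theorem for a subquotient `N' / N` of a module over a solvable Lie algebra. -/
theorem exists_weightVector_mod {𝔟 V : Type*} [LieRing 𝔟] [LieAlgebra K 𝔟] [IsSolvable 𝔟]
    [AddCommGroup V] [Module K V] [FiniteDimensional K V] [LieRingModule 𝔟 V] [LieModule K 𝔟 V]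
    {N N' : LieSubmodule K 𝔟 V} (h : ¬ N' ≤ N) :
    ∃ w ∈ N', w ∉ N ∧ ∃ χ : 𝔟 → K, ∀ x, ⁅x, w⁆ - χ x • w ∈ N := by
  let π := LieSubmodule.Quotient.mk' N
  have hπ (v : V) : π v = 0 ↔ v ∈ N := LieSubmodule.Quotient.mk_eq_zero'
  have : Nontrivial (N'.map π) := by
    obtain ⟨v, hv, hvN⟩ := SetLike.not_le_iff_exists.mp h
    refine ⟨⟨π v, (LieSubmodule.mem_map _).mpr ⟨v, hv, rfl⟩⟩, 0, fun h0 ↦ hvN ((hπ v).mp ?_)⟩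
    exact congrArg Subtype.val h0
  obtain ⟨χ, hχ⟩ := exists_nontrivial_weightSpace_of_isSolvable K 𝔟 (N'.map π)
  obtain ⟨⟨⟨w', hw'⟩, hw⟩, hne⟩ := exists_ne (0 : weightSpace (N'.map π) χ)
  obtain ⟨w, hwN', rfl⟩ := (LieSubmodule.mem_map _).mp hw'
  refine ⟨w, hwN', fun hwN ↦ hne ?_, χ, fun x ↦ ?_⟩
  · exact Subtype.ext (Subtype.ext ((hπ w).mpr hwN))
  · have := congrArg Subtype.val ((mem_weightSpace _ _).mp hw x)
    rw [← hπ, map_sub, map_smul, π.map_lie, sub_eq_zero]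
    exact this

variable {L : Type*} [LieRing L] [LieAlgebra K L] [FiniteDimensional K L]

/-- A solvable ideal containing its orthogonal contains a subalgebra which is maximal totally
isotropic in the whole Lie algebra and nilpotent of class at most two. -/
theorem exists_maximal_isotropic (s : LinearMap.BilinForm K L) (hs : s.lieInvariant L)
    (hsymm : ∀ x y, s x y = s y x) (hnd : ∀ x, (∀ y, s x y = 0) → x = 0)
    (𝔟 : LieIdeal K L) [IsSolvable 𝔟] (h𝔟 : orthogonal s hs 𝔟 ≤ 𝔟) :
    ∃ U : Submodule K L, U ≤ 𝔟.toSubmodule ∧ (∀ x ∈ U, ∀ y ∈ U, s x y = 0) ∧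
      (∀ x, (∀ u ∈ U, s u x = 0) → s x x = 0 → x ∈ U) ∧
      (∀ x ∈ U, ∀ y ∈ U, ⁅x, y⁆ ∈ U) ∧
      ∀ x ∈ U, ∀ y ∈ U, ∀ z ∈ U, ⁅x, ⁅y, z⁆⁆ = 0 := by
  have hs' (x y z : L) : s y ⁅x, z⁆ = -s ⁅x, y⁆ z := by rw [hs, neg_neg]
  have hdouble {x : L} (hx : ∀ u ∈ orthogonal s hs 𝔟, s u x = 0) : x ∈ 𝔟 := by
    have hnd' : s.Nondegenerate := ⟨hnd, fun x hx ↦ hnd x fun y ↦ hsymm x y ▸ hx y⟩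
    have := LinearMap.BilinForm.orthogonal_orthogonal hnd'
      (fun x y h ↦ (hsymm x y).symm.trans h) 𝔟.toSubmodule
    exact this.le hx
  let P (N : LieSubmodule K 𝔟 L) : Prop :=
    (∀ x ∈ N, ∀ y ∈ N, s x y = 0) ∧ (∀ x ∈ orthogonal s hs 𝔟, x ∈ N) ∧ ∀ x ∈ N, x ∈ 𝔟
  obtain ⟨N, ⟨hNiso, hbN, hNb⟩, hmax⟩ : ∃ N, Maximal P N := by
    refine exists_maximal_of_wellFoundedGT P ⟨{ (orthogonal s hs 𝔟).toSubmodule with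
      lie_mem := fun {x y} hy ↦ ?_ }, ?_, fun x hx ↦ hx, fun x hx ↦ h𝔟 hx⟩
    · exact lie_mem_right K L (orthogonal s hs 𝔟) x y hy
    · exact fun x hx y hy ↦ (mem_orthogonal s hs 𝔟 y).mp hy x (h𝔟 hx)
  have hlieN {x y : L} (hx : x ∈ 𝔟) (hy : y ∈ N) : ⁅x, y⁆ ∈ N := N.lie_mem (x := ⟨x, hx⟩) hy
  let Np : LieSubmodule K 𝔟 L :=
    { s.orthogonal N.toSubmodule with
      lie_mem := fun {x y} hy n hn ↦ by
        have h1 : s ⁅(x : L), n⁆ y = 0 := hy _ (hlieN x.2 hn)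
        exact (hs' x n y).trans (by rw [h1, neg_zero]) }
  have hNp {x : L} : x ∈ Np ↔ ∀ u ∈ N, s u x = 0 := Iff.rfl
  have extend {y : L} (hy : y ∈ Np) (hyy : s y y = 0) (χ : 𝔟 → K)
      (hχ : ∀ x : 𝔟, ⁅x, y⁆ - χ x • y ∈ N) : y ∈ N := by
    have hmem {m : L} : m ∈ N.toSubmodule ⊔ Submodule.span K {y} ↔
        ∃ n ∈ N, ∃ c : K, n + c • y = m := by
      simp [Submodule.mem_sup, Submodule.mem_span_singleton]
    let N' : LieSubmodule K 𝔟 L :=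
      { N.toSubmodule ⊔ Submodule.span K {y} with
        lie_mem := fun {x m} hm ↦ by
          obtain ⟨n, hn, c, rfl⟩ := hmem.mp hm
          refine hmem.mpr
            ⟨⁅x, n⁆ + c • (⁅x, y⁆ - χ x • y), ?_, c * χ x, ?_⟩
          · exact N.add_mem (N.lie_mem hn) (N.smul_mem c (hχ x))
          · rw [lie_add, lie_smul, smul_sub, mul_smul]; abel }
    have hle : N ≤ N' := fun n hn ↦ hmem.mpr ⟨n, hn, 0, by simp⟩
    refine hmax (y := N') ⟨?_, fun x hx ↦ hle (hbN x hx), ?_⟩ hle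
      (hmem.mpr ⟨0, N.zero_mem, 1, by simp⟩)
    · intro m hm m' hm'
      obtain ⟨n, hn, c, rfl⟩ := hmem.mp hm
      obtain ⟨n', hn', c', rfl⟩ := hmem.mp hm'
      simp [hNiso n hn n' hn', hNp.mp hy n hn, hsymm y n', hNp.mp hy n' hn', hyy]
    · intro m hm
      obtain ⟨n, hn, c, rfl⟩ := hmem.mp hm
      exact 𝔟.add_mem (hNb n hn) (𝔟.smul_mem c (hdouble fun u hu ↦ hNp.mp hy u (hbN u hu)))
  have weight {w : L} (hw : w ∈ Np) (hwN : w ∉ N) (χ : 𝔟 → K)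
      (hχ : ∀ x : 𝔟, ⁅x, w⁆ - χ x • w ∈ N) : s w w ≠ 0 ∧ ∀ x : 𝔟, ⁅x, w⁆ ∈ N := by
    have hww : s w w ≠ 0 := fun h0 ↦ hwN (extend hw h0 χ hχ)
    refine ⟨hww, fun x ↦ ?_⟩
    have h1 : s ⁅(x : L), w⁆ w = 0 := by
      have := hs x w w
      rwa [hsymm w, self_eq_neg] at this
    have h2 := hNp.mp hw _ (hχ x)
    rw [LieIdeal.coe_bracket_of_module, map_sub, map_smul, LinearMap.sub_apply, h1, zero_sub,
      LinearMap.smul_apply, smul_eq_mul, neg_eq_zero, mul_eq_zero_iff_right hww] at h2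
    simpa [h2] using hχ x
  refine ⟨N.toSubmodule, hNb, hNiso, fun x hx hxx ↦ ?_, fun x hx y hy ↦ hlieN (hNb x hx) hy,
    fun x hx y hy z hz ↦ ?_⟩
  · by_contra hxN
    obtain ⟨w, hw, hwN, χ, hχ⟩ := exists_weightVector_mod
      (SetLike.not_le_iff_exists.mpr ⟨x, hNp.mpr hx, hxN⟩)
    obtain ⟨hww, hbw⟩ := weight hw hwN χ hχ
    let U : LieSubmodule K 𝔟 L :=
      { Np.toSubmodule ⊓ LinearMap.ker (s w) with
        lie_mem := fun {a u} hu ↦ ⟨Np.lie_mem hu.1, by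
          have h1 : s ⁅(a : L), w⁆ u = 0 := hNp.mp hu.1 _ (hbw a)
          exact (hs' a w u).trans (by rw [h1, neg_zero])⟩ }
    have hU {u : L} : u ∈ U ↔ u ∈ Np ∧ s w u = 0 := Iff.rfl
    have hUN : ¬ U ≤ N := fun hle ↦ by
      have hx' : x - (s w x / s w w) • w ∈ N := hle (hU.mpr
        ⟨Np.sub_mem (hNp.mpr hx) (Np.smul_mem _ hw), by simp [hww]⟩)
      have h1 := hx _ hx'
      rw [map_sub, map_smul, LinearMap.sub_apply, LinearMap.smul_apply, smul_eq_mul, hxx, zero_sub,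
        neg_eq_zero, div_mul_eq_mul_div, div_eq_zero_iff, mul_self_eq_zero] at h1
      rw [h1.resolve_right hww, zero_div, zero_smul, sub_zero] at hx'
      exact hxN hx'
    obtain ⟨w', hw', hwN', χ', hχ'⟩ := exists_weightVector_mod hUN
    obtain ⟨hww', hbw'⟩ := weight (hU.mp hw').1 hwN' χ' hχ'
    obtain ⟨t, ht⟩ := IsAlgClosed.exists_pow_nat_eq (-s w w / s w' w') two_pos
    have hy : w + t • w' ∈ N := by
      refine extend (Np.add_mem hw (Np.smul_mem t (hU.mp hw').1)) ?_ 0 fun a ↦ ?_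
      · have : t ^ 2 * s w' w' = - s w w := by rw [ht, div_mul_cancel₀ _ hww']
        simp only [map_add, map_smul, LinearMap.add_apply, LinearMap.smul_apply, smul_eq_mul,
          (hU.mp hw').2, hsymm w' w]
        linear_combination this
      · rw [Pi.zero_apply, zero_smul, sub_zero, lie_add, lie_smul]
        exact N.add_mem (hbw a) (N.smul_mem t (hbw' a))
    have := hNp.mp hw _ hy
    rw [map_add, map_smul, LinearMap.add_apply, LinearMap.smul_apply, hsymm w', (hU.mp hw').2,
      smul_zero, add_zero] at this
    exact hww this
  · have hyz : ⁅y, z⁆ ∈ orthogonal s hs 𝔟 := by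
      rw [InvariantForm.mem_orthogonal]
      intro a ha
      rw [hs', ← lie_skew, map_neg, LinearMap.neg_apply, hNiso _ (hlieN ha hy) z hz, neg_zero,
        neg_zero]
    refine hnd _ fun r ↦ ?_
    rw [hs, hsymm, (mem_orthogonal s hs 𝔟 _).mp hyz _ (lie_mem_left K L 𝔟 x r (hNb x hx)), neg_zero]

end MaximalIsotropic

section Leibniz

variable {M : Type*} [AddCommGroup M] [Module ℂ M] {br : M →ₗ[ℂ] M →ₗ[ℂ] M}

theorem add_swap_mem_leibnizKernel (a b : M) : br a b + br b a ∈ leibnizKernel br := by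
  have h (x : M) : br x x ∈ leibnizKernel br := Submodule.subset_span ⟨x, rfl⟩
  have := sub_mem (sub_mem (h (a + b)) (h a)) (h b)
  simp only [map_add, LinearMap.add_apply] at this
  convert this using 1
  abel

theorem IsLeftCentral.bracket_leibnizKernel (hcent : IsLeftCentral br) (a : M) {x : M}
    (hx : x ∈ leibnizKernel br) : br a x = 0 := by
  have : leibnizKernel br ≤ LinearMap.ker (br a) :=
    Submodule.span_le.mpr fun _ ⟨b, hb⟩ ↦ hb ▸ hcent a b
  exact this hx

theorem IsLeftLeibniz.leibnizKernel_bracket (hleib : IsLeftLeibniz br) {x : M}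
    (hx : x ∈ leibnizKernel br) (a : M) : br x a = 0 := by
  have : leibnizKernel br ≤ LinearMap.ker (br.flip a) :=
    Submodule.span_le.mpr fun _ ⟨b, hb⟩ ↦ hb ▸ by simpa using hleib b b a
  exact this hx

/-- The quotient of a left Leibniz algebra by a two-sided ideal containing the Leibniz kernel is a
Lie algebra. -/
theorem IsLeftLeibniz.exists_lie_quotient.{u} {M : Type u} [AddCommGroup M] [Module ℂ M]
    {br : M →ₗ[ℂ] M →ₗ[ℂ] M} (hleib : IsLeftLeibniz br) (I : Submodule ℂ M)
    (hI : IsTwoSidedIdeal br I) (hker : leibnizKernel br ≤ I) :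
    ∃ (𝔤 : Type u) (_ : LieRing 𝔤) (_ : LieAlgebra ℂ 𝔤) (q : M →ₗ[ℂ] 𝔤),
      Function.Surjective q ∧ (∀ x, q x = 0 ↔ x ∈ I) ∧ ∀ a b, q (br a b) = ⁅q a, q b⁆ := by
  let q := I.mkQ
  have hq (x : M) : q x = 0 ↔ x ∈ I := Submodule.Quotient.mk_eq_zero I
  have hqs : Function.Surjective q := I.mkQ_surjective
  obtain ⟨σ, hσ⟩ := q.exists_rightInverse_of_surjective (LinearMap.range_eq_top.mpr hqs)
  replace hσ (x : M ⧸ I) : q (σ x) = x := LinearMap.congr_fun hσ x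
  let β : (M ⧸ I) →ₗ[ℂ] (M ⧸ I) →ₗ[ℂ] (M ⧸ I) := (br.compl₁₂ σ σ).compr₂ q
  have hβ (a b : M) : β (q a) (q b) = q (br a b) := by
    have h (x : M) : σ (q x) - x ∈ I := by rw [← hq, map_sub, hσ, sub_self]
    have := I.add_mem (hI (σ (q a)) _ (h b)).1 (hI b _ (h a)).2
    rw [map_sub, map_sub, LinearMap.sub_apply, sub_add_sub_cancel, ← hq, map_sub, sub_eq_zero]
      at this
    exact this
  let _ : LieRing (M ⧸ I) :=
    { bracket := fun x y ↦ β x y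
      add_lie := fun x y z ↦ by simp
      lie_add := fun x y z ↦ by simp
      lie_self := fun x ↦ by
        obtain ⟨x, rfl⟩ := hqs x
        exact (hβ x x).trans ((hq _).mpr (hker (Submodule.subset_span ⟨x, rfl⟩)))
      leibniz_lie := fun x y z ↦ by
        obtain ⟨x, rfl⟩ := hqs x
        obtain ⟨y, rfl⟩ := hqs y
        obtain ⟨z, rfl⟩ := hqs z
        simp only [hβ, hleib x y z, map_add] }
  let _ : LieAlgebra ℂ (M ⧸ I) := { lie_smul := fun t x y ↦ map_smul (β x) t y }
  exact ⟨M ⧸ I, inferInstance, inferInstance, q, hqs, hq, fun a b ↦ (hβ a b).symm⟩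

/-- If the Leibniz kernel is one-dimensional, the pairing `[a, b] + [b, a]` is represented by a
symmetric bilinear form for which left multiplications are skew-adjoint. -/
theorem exists_invariant_form (hleib : IsLeftLeibniz br) (hcent : IsLeftCentral br)
    (hrk : Module.finrank ℂ (leibnizKernel br) = 1) :
    ∃ s : LinearMap.BilinForm ℂ M, (∀ x y, s x y = s y x) ∧
      (∀ x y, s x y = 0 ↔ br x y + br y x = 0) ∧ ∀ x y z, s (br x y) z = -s y (br x z) := by
  obtain ⟨e⟩ : Nonempty (leibnizKernel br ≃ₗ[ℂ] ℂ) :=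
    have := Module.finite_of_finrank_pos (hrk ▸ one_pos)
    FiniteDimensional.nonempty_linearEquiv_of_finrank_eq (hrk.trans (Module.finrank_self ℂ).symm)
  obtain ⟨ξ, hξ⟩ := LinearMap.exists_extend (p := leibnizKernel br) e.toLinearMap
  have hξ0 {x : M} (hx : x ∈ leibnizKernel br) (h : ξ x = 0) : x = 0 := by
    have : e ⟨x, hx⟩ = 0 := (LinearMap.congr_fun hξ ⟨x, hx⟩).symm.trans h
    exact congrArg Subtype.val (e.map_eq_zero_iff.mp this)
  refine ⟨(br + br.flip).compr₂ ξ, fun x y ↦ ?_, fun x y ↦ ⟨fun h ↦ ?_, fun h ↦ ?_⟩,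
    fun x y z ↦ ?_⟩
  · simp [add_comm]
  · exact hξ0 (add_swap_mem_leibnizKernel x y) h
  · simpa using congrArg ξ h
  · have h := hcent.bracket_leibnizKernel x (add_swap_mem_leibnizKernel (br := br) y z)
    rw [map_add, hleib x y z, hleib x z y] at h
    have h' := congrArg ξ h
    simp only [map_add, map_zero] at h'
    simp only [LinearMap.compr₂_apply, LinearMap.add_apply, LinearMap.flip_apply, map_add]
    linear_combination h'

end Leibniz

/-- (Theorem 5.1)  A left central Leibniz algebra of rank `1` possesses a
maximal Lie subalgebra `L` which is a maximal totally isotropic subspace, with `L/R`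
nilpotent and `L ⊆ B`. -/
theorem rank_one_maximal_isotropic_lie (M : Type*) [AddCommGroup M] [Module ℂ M]
    [FiniteDimensional ℂ M] (br : M →ₗ[ℂ] M →ₗ[ℂ] M) (hleib : IsLeftLeibniz br)
    (hcent : IsLeftCentral br)
    (hrk : Module.finrank ℂ (leibnizKernel br) = 1)
    (R : Submodule ℂ M) (hR : ∀ x : M, x ∈ R ↔ ∀ a : M, br x a + br a x = 0)
    (B : Submodule ℂ M) (hRB : R ≤ B) (hB : IsSolvableRadicalMod br R B) :
    ∃ L : Submodule ℂ M,
      IsLieSubalgebra br L ∧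
      (∀ L' : Submodule ℂ M, IsLieSubalgebra br L' → L ≤ L' → L' = L) ∧
      IsTotallyIsotropic br L ∧
      (∀ U : Submodule ℂ M, IsTotallyIsotropic br U → L ≤ U → U = L) ∧
      R ≤ L ∧ IsNilpotentMod br R L ∧ L ≤ B := by
  obtain ⟨s, hsymm, hψ, hinv⟩ := exists_invariant_form hleib hcent hrk
  have hRs {x : M} : x ∈ R ↔ ∀ y, s x y = 0 := by simp only [hR, hψ]
  have hCR : leibnizKernel br ≤ R := fun x hx ↦ (hR x).mpr fun a ↦ by
    rw [hcent.bracket_leibnizKernel a hx, hleib.leibnizKernel_bracket hx, add_zero]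
  have hC : IsTwoSidedIdeal br (leibnizKernel br) := fun m u hu ↦ by
    rw [hcent.bracket_leibnizKernel m hu, hleib.leibnizKernel_bracket hu]
    exact ⟨zero_mem _, zero_mem _⟩
  have hRideal : IsTwoSidedIdeal br R := fun m u hu ↦ by
    have h : br m u ∈ R := hRs.mpr fun z ↦ by rw [hinv, hRs.mp hu, neg_zero]
    refine ⟨h, ?_⟩
    rw [eq_neg_of_add_eq_zero_left ((hR u).mp hu m)]
    exact R.neg_mem h
  obtain ⟨G, _, _, r, hr, hr0, hrbr⟩ := hleib.exists_lie_quotient _ hC le_rfl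
  obtain ⟨𝔤, _, _, q, hq, hq0, hqbr⟩ := hleib.exists_lie_quotient R hRideal hCR
  have : FiniteDimensional ℂ G := Module.Finite.of_surjective r hr
  have : FiniteDimensional ℂ 𝔤 := Module.Finite.of_surjective q hq
  obtain ⟨ρ, hρ⟩ := r.exists_rightInverse_of_surjective (LinearMap.range_eq_top.mpr hr)
  replace hρ (x : G) : r (ρ x) = x := LinearMap.congr_fun hρ x
  obtain ⟨σ, hσ⟩ := q.exists_rightInverse_of_surjective (LinearMap.range_eq_top.mpr hq)
  replace hσ (x : 𝔤) : q (σ x) = x := LinearMap.congr_fun hσ x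
  have hqρ (x : M) : q (ρ (r x)) = q x := by
    rw [← sub_eq_zero, ← map_sub, hq0]
    refine hCR ?_
    rw [← hr0, map_sub, hρ, sub_self]
  let p : G →ₗ⁅ℂ⁆ 𝔤 :=
    { q ∘ₗ ρ with
      map_lie' := fun {x y} ↦ by
        obtain ⟨x, rfl⟩ := hr x
        obtain ⟨y, rfl⟩ := hr y
        change q (ρ _) = ⁅q (ρ _), q (ρ _)⁆
        rw [← hrbr, hqρ, hqρ, hqρ, hqbr] }
  have hp (x : M) : p (r x) = q x := hqρ x
  let Φ : LinearMap.BilinForm ℂ 𝔤 := s.compl₁₂ σ σ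
  have hΦ (x y : M) : Φ (q x) (q y) = s x y := by
    have h (x : M) : σ (q x) - x ∈ R := by rw [← hq0, map_sub, hσ, sub_self]
    have h1 := hRs.mp (h x) (σ (q y))
    have h2 := hRs.mp (h y) x
    rw [hsymm, map_sub] at h2
    rw [map_sub, LinearMap.sub_apply] at h1
    exact (sub_eq_zero.mp h1).trans (sub_eq_zero.mp h2)
  have hΦinv : Φ.lieInvariant 𝔤 := fun x y z ↦ by
    obtain ⟨x, rfl⟩ := hq x
    obtain ⟨y, rfl⟩ := hq y
    obtain ⟨z, rfl⟩ := hq z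
    rw [← hqbr, ← hqbr, hΦ, hΦ, hinv]
  have hΦsymm (x y : 𝔤) : Φ x y = Φ y x := hsymm _ _
  have hΦnd (x : 𝔤) (hx : ∀ y, Φ x y = 0) : x = 0 := by
    obtain ⟨x, rfl⟩ := hq x
    exact (hq0 x).mpr (hRs.mpr fun y ↦ hΦ x y ▸ hx (q y))
  have hsl2 (h e f : G) (t : IsSl2TripleMod (⊥ : LieIdeal ℂ G) h e f) :
      Φ (p h) (p h) = 0 := by
    obtain ⟨H, rfl⟩ := hr h
    obtain ⟨E, rfl⟩ := hr e
    obtain ⟨F, rfl⟩ := hr f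
    obtain ⟨h1, h2, h3⟩ := t
    rw [LieSubmodule.mem_bot, ← hrbr, ← map_smul] at h1 h2
    rw [LieSubmodule.mem_bot, ← hrbr, ← map_sub, hr0] at h3
    rw [← map_sub, hr0] at h1
    rw [← map_add, hr0] at h2
    rw [hp, hΦ, hψ]
    have e1 := hcent.bracket_leibnizKernel H h3
    have e2 := hleib.leibnizKernel_bracket h1 F
    have e3 := hcent.bracket_leibnizKernel E h2
    rw [map_sub, hleib] at e1
    simp only [map_sub, map_add, map_smul, LinearMap.sub_apply, LinearMap.smul_apply] at e2 e3
    rw [sub_eq_zero.mp e2, eq_neg_of_add_eq_zero_left e3, add_neg_cancel, zero_sub,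
      neg_eq_zero] at e1
    rw [e1, add_zero]
  set 𝔟 := LieAlgebra.radical ℂ 𝔤
  obtain ⟨U, hU𝔟, hUiso, hUmax, hUlie, hUnil⟩ := exists_maximal_isotropic Φ hΦinv hΦsymm hΦnd 𝔟
    (orthogonal_radical_le Φ hΦinv hΦsymm hΦnd p (fun y ↦ by
      obtain ⟨y, rfl⟩ := hq y
      exact ⟨r y, hp y⟩) hsl2)
  have hRle (V : Submodule ℂ 𝔤) : R ≤ V.comap q := fun x hx ↦ by
    rw [Submodule.mem_comap, (hq0 x).mpr hx]
    exact V.zero_mem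
  have hiso : IsTotallyIsotropic br (U.comap q) := fun a ha b hb ↦ by
    rw [← hψ, ← hΦ]
    exact hUiso _ ha _ hb
  have hmax (V : Submodule ℂ M) (hV : IsTotallyIsotropic br V) (hle : U.comap q ≤ V) :
      V = U.comap q := by
    refine le_antisymm (fun x hx ↦ hUmax _ (fun u hu ↦ ?_) ?_) hle
    · obtain ⟨u, rfl⟩ := hq u
      exact hΦ u x ▸ (hψ u x).mpr (hV u (hle hu) x hx)
    · exact hΦ x x ▸ (hψ x x).mpr (hV x hx x hx)
  refine ⟨U.comap q, ⟨fun a ha b hb ↦ ?_, fun a ha ↦ ?_⟩, fun L' hL' ↦ hmax L' fun a ha b hb ↦ ?_,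
    hiso, hmax, hRle U, ⟨2, ?_⟩, ?_⟩
  · rw [Submodule.mem_comap, hqbr]
    exact hUlie _ ha _ hb
  · simpa [← two_smul ℂ] using hiso a ha a ha
  · simpa [hL'.2 a ha, hL'.2 b hb, add_comm] using hL'.2 _ (L'.add_mem ha hb)
  · let Z : Submodule ℂ 𝔤 := ⨅ x ∈ U, LinearMap.ker (LieAlgebra.ad ℂ 𝔤 x : 𝔤 →ₗ[ℂ] 𝔤)
    have hZ {z : 𝔤} : z ∈ Z ↔ ∀ x ∈ U, ⁅x, z⁆ = 0 := by simp [Z]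
    have h1 : lowerCentralSeriesMod br R (U.comap q) 1 ≤ Z.comap q := by
      refine sup_le (Submodule.span_le.mpr ?_) (hRle Z)
      rintro _ ⟨a, ha, b, hb, rfl⟩
      rw [lowerCentralSeriesMod, sup_eq_left.mpr (hRle U)] at hb
      rw [SetLike.mem_coe, Submodule.mem_comap, hqbr, hZ]
      exact fun x hx ↦ hUnil x hx _ ha _ hb
    refine sup_le (Submodule.span_le.mpr ?_) le_rfl
    rintro _ ⟨a, ha, b, hb, rfl⟩
    rw [SetLike.mem_coe, ← hq0, hqbr]
    exact hZ.mp (h1 hb) _ ha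
  · refine (Submodule.comap_mono hU𝔟).trans (hB.2.2 _ ⟨hRle _, fun m a ha ↦ ?_⟩ ?_)
    · simp only [Submodule.mem_comap, hqbr] at ha ⊢
      exact ⟨lie_mem_right ℂ 𝔤 𝔟 _ _ ha, lie_mem_left ℂ 𝔤 𝔟 _ _ ha⟩
    · obtain ⟨k, hk⟩ := LieAlgebra.IsSolvable.solvable ℂ 𝔟
      rw [LieIdeal.derivedSeries_eq_bot_iff] at hk
      have hle (n : ℕ) : derivedSeriesMod br R (𝔟.toSubmodule.comap q) n ≤
          (LieAlgebra.derivedSeriesOfIdeal ℂ 𝔤 n 𝔟).toSubmodule.comap q := by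
        induction n with
        | zero => exact sup_le le_rfl (hRle _)
        | succ n ih =>
          refine sup_le (Submodule.span_le.mpr ?_) (hRle _)
          rintro _ ⟨a, ha, b, hb, rfl⟩
          rw [SetLike.mem_coe, Submodule.mem_comap, hqbr, LieAlgebra.derivedSeriesOfIdeal_succ]
          exact LieSubmodule.lie_mem_lie (ih ha) (ih hb)
      refine ⟨k, (hle k).trans fun x hx ↦ ?_⟩
      rw [hk] at hx
      exact (hq0 x).mp hx
end

section
/- Let M be a finite-dimensional complex left Leibniz algebra with radical R. Then M is a symmetric Leibniz algebra (i.e., also satisfies the right Leibniz identity [[a,b],c] = [[a,c],b] + [a,[b,c]] for all a,b,c ∈ M) if and only if the derived subalgebra [M,M] is contained in R, equivalently ψ([a,b],c) = 0 for all a,b,c ∈ M. -/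
open Submodule

theorem IsLeftLeibniz.isRightLeibniz_iff {M : Type*} [AddCommGroup M] [Module ℂ M]
    {br : M →ₗ[ℂ] M →ₗ[ℂ] M} (h : IsLeftLeibniz br) :
    IsRightLeibniz br ↔ ∀ a b c : M, br (br a b) c + br c (br a b) = 0 := by
  constructor
  · intro hr a b c
    grind [hr a c b, h a c b]
  · intro hz a b c
    grind [hz a c b, h a b c]

/-- (Lemma 6.1)  A left Leibniz algebra is symmetric iff its derived
subalgebra lies in the radical `R` of `ψ`, iff `ψ([a,b], c) = 0` for all `a, b, c`. -/
theorem symmetric_iff_derived_in_radical (M : Type*) [AddCommGroup M] [Module ℂ M]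
    [FiniteDimensional ℂ M] (br : M →ₗ[ℂ] M →ₗ[ℂ] M) (hleib : IsLeftLeibniz br)
    (R : Submodule ℂ M) (hR : ∀ x : M, x ∈ R ↔ ∀ a : M, br x a + br a x = 0) :
    (IsRightLeibniz br ↔ Submodule.span ℂ {x | ∃ a b : M, br a b = x} ≤ R) ∧
    (IsRightLeibniz br ↔ ∀ a b c : M, br (br a b) c + br c (br a b) = 0) := by
  refine ⟨hleib.isRightLeibniz_iff.trans ?_, hleib.isRightLeibniz_iff⟩
  rw [Submodule.span_le]
  constructor
  · rintro h _ ⟨a, b, rfl⟩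
    exact (hR _).2 (h a b)
  · intro h a b
    exact (hR _).1 (h ⟨a, b, rfl⟩)
end

section
/- Let L₁, L₂, R, Z, α, ψ' be as in the left central Leibniz algebra construction (Lie algebras L₁, L₂ with common ideal R, L₂/R abelian, Z = R ∩ Z(L₁) ∩ Z(L₂), α : L₁ → Der(L₂) a Lie morphism with x·y = [x,y] when x ∈ R or y ∈ R, and ψ' : L₁ × L₂ → Z bilinear with ψ'([x₁,x₂],y) = ψ'(x₁,x₂·y) and R = {x ∈ L₁ : ψ'(x,L₂) = 0} = {y ∈ L₂ : ψ'(L₁,y) = 0}), and let M = L₁ ⊕ L₂ carry the bracket [(x₁,y₁),(x₂,y₂)] := ([x₁,x₂], x₁·y₂ − x₂·y₁ + [y₁,y₂] + ψ'(x₂,y₁)). Then M is a symmetric Leibniz algebra (satisfies the right Leibniz identity) if and only if [L₁,L₁] ⊆ R, i.e., if and only if L₁/R and L₂/R are both abelian Lie algebras. -/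
open Submodule

/-- (Lemma 6.2)  The Leibniz algebra `M = L₁ ⊕ L₂` built from the data
`(L₁, L₂, R, α, ψ')` is a symmetric Leibniz algebra iff `[L₁, L₁] ⊆ R`, iff `L₁/R` and
`L₂/R` are both abelian. -/
theorem construction_symmetric_iff_abelian (R L₁ L₂ : Type*)
    [LieRing R] [LieAlgebra ℂ R] [FiniteDimensional ℂ R]
    [LieRing L₁] [LieAlgebra ℂ L₁] [FiniteDimensional ℂ L₁]
    [LieRing L₂] [LieAlgebra ℂ L₂] [FiniteDimensional ℂ L₂]
    (f₁ : R →ₗ⁅ℂ⁆ L₁) (f₂ : R →ₗ⁅ℂ⁆ L₂)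
    (hf₁ : Function.Injective f₁) (hf₂ : Function.Injective f₂)
    (hf₁ideal : ∀ (x : L₁) (r : R), ⁅x, f₁ r⁆ ∈ LinearMap.range (f₁ : R →ₗ[ℂ] L₁))
    (hf₂ideal : ∀ (y : L₂) (r : R), ⁅y, f₂ r⁆ ∈ LinearMap.range (f₂ : R →ₗ[ℂ] L₂))
    (habelian : ∀ y₁ y₂ : L₂, ⁅y₁, y₂⁆ ∈ LinearMap.range (f₂ : R →ₗ[ℂ] L₂))
    (α : L₁ →ₗ[ℂ] L₂ →ₗ[ℂ] L₂)
    (hα₁ : ∀ (x₁ x₂ : L₁) (y : L₂), α ⁅x₁, x₂⁆ y = α x₁ (α x₂ y) - α x₂ (α x₁ y))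
    (hα₂ : ∀ (x : L₁) (y₁ y₂ : L₂), α x ⁅y₁, y₂⁆ = ⁅α x y₁, y₂⁆ + ⁅y₁, α x y₂⁆)
    (hα₃ : ∀ (r : R) (y : L₂), α (f₁ r) y = ⁅f₂ r, y⁆)
    (hα₄ : ∀ (x : L₁) (r r' : R), f₁ r' = ⁅x, f₁ r⁆ → α x (f₂ r) = f₂ r')
    (ψ' : L₁ →ₗ[ℂ] L₂ →ₗ[ℂ] R)
    (hZ : ∀ (x : L₁) (y : L₂),
      (∀ w : L₁, ⁅f₁ (ψ' x y), w⁆ = 0) ∧ (∀ w : L₂, ⁅f₂ (ψ' x y), w⁆ = 0))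
    (hassoc : ∀ (x₁ x₂ : L₁) (y : L₂), ψ' ⁅x₁, x₂⁆ y = ψ' x₁ (α x₂ y))
    (hrad₁ : ∀ x : L₁, (∀ y : L₂, ψ' x y = 0) ↔ x ∈ LinearMap.range (f₁ : R →ₗ[ℂ] L₁))
    (hrad₂ : ∀ y : L₂, (∀ x : L₁, ψ' x y = 0) ↔ y ∈ LinearMap.range (f₂ : R →ₗ[ℂ] L₂))
    (br : (L₁ × L₂) →ₗ[ℂ] (L₁ × L₂) →ₗ[ℂ] (L₁ × L₂))
    (hbr : ∀ p q : L₁ × L₂,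
      br p q = (⁅p.1, q.1⁆, α p.1 q.2 - α q.1 p.2 + ⁅p.2, q.2⁆ + f₂ (ψ' q.1 p.2))) :
    (IsRightLeibniz br ↔
      ∀ x₁ x₂ : L₁, ⁅x₁, x₂⁆ ∈ LinearMap.range (f₁ : R →ₗ[ℂ] L₁)) ∧
    (IsRightLeibniz br ↔
      ((∀ x₁ x₂ : L₁, ⁅x₁, x₂⁆ ∈ LinearMap.range (f₁ : R →ₗ[ℂ] L₁)) ∧
       (∀ y₁ y₂ : L₂, ⁅y₁, y₂⁆ ∈ LinearMap.range (f₂ : R →ₗ[ℂ] L₂)))) := by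
  have hψ₂ : ∀ (x : L₁) (r : R), ψ' x (f₂ r) = 0 := fun x r => (hrad₂ (f₂ r)).2 ⟨r, rfl⟩ x
  have hψcomm : ∀ (x : L₁) (y₁ y₂ : L₂), ψ' x ⁅y₁, y₂⁆ = 0 := fun x y₁ y₂ =>
    (hrad₂ _).2 (habelian y₁ y₂) x
  have hαψ : ∀ (w x : L₁) (y : L₂), α w (f₂ (ψ' x y)) = 0 := by
    intro w x y
    have h := hα₄ w (ψ' x y) 0 (by rw [map_zero, ← lie_skew, (hZ x y).1, neg_zero])
    rwa [map_zero] at h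
  have hψlie : ∀ (x : L₁) (y w : L₂), ⁅f₂ (ψ' x y), w⁆ = 0 := fun x y => (hZ x y).2
  have hlieψ : ∀ (x : L₁) (y w : L₂), ⁅w, f₂ (ψ' x y)⁆ = 0 := by
    intro x y w
    rw [← lie_skew, hψlie, neg_zero]
  have main : IsRightLeibniz br ↔
      ∀ x₁ x₂ : L₁, ⁅x₁, x₂⁆ ∈ LinearMap.range (f₁ : R →ₗ[ℂ] L₁) := by
    constructor
    · intro h x₁ x₂
      refine (hrad₁ _).1 fun y => hf₂ ?_
      have h := congrArg Prod.snd (h (0, y) (x₁, 0) (x₂, 0))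
      have hskew : ψ' ⁅x₂, x₁⁆ y = -ψ' ⁅x₁, x₂⁆ y := by
        rw [← lie_skew, map_neg, LinearMap.neg_apply]
      simp only [hbr, Prod.snd_add, map_add, map_neg, map_zero, neg_zero,
        lie_zero, zero_lie, zero_sub, add_zero, hαψ, hψ₂, ← hassoc, hα₁, hskew] at h
      rw [map_zero, ← sub_eq_zero.2 h]
      abel
    · intro h ⟨x₁, y₁⟩ ⟨x₂, y₂⟩ ⟨x₃, y₃⟩
      have hψ : ∀ (x x' : L₁) (y : L₂), ψ' ⁅x, x'⁆ y = 0 := fun x x' => (hrad₁ _).2 (h x x')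
      have hψα : ∀ (x x' : L₁) (y : L₂), ψ' x (α x' y) = 0 := fun x x' y => by
        rw [← hassoc, hψ]
      simp only [hbr]
      refine Prod.ext ?_ ?_
      · simp only [Prod.fst_add]
        rw [lie_lie, ← lie_skew x₂ ⁅x₁, x₃⁆]
        abel
      · simp only [Prod.snd_add, map_add, map_sub,
          add_lie, sub_lie, lie_add, lie_sub, hα₁, hα₂, hαψ, hψlie, hlieψ, hψ₂, hψcomm, hψ, hψα,
          map_zero]
        rw [lie_lie y₁ y₂ y₃, ← lie_skew (α x₂ y₁) y₃, ← lie_skew y₂ ⁅y₁, y₃⁆,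
          ← lie_skew y₂ (α x₁ y₃)]
        abel
  exact ⟨main, main.trans (and_iff_left habelian).symm⟩
end
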